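/- Let q be a power of two and let f ∈ F_q[x] have degree less than (1/2)·q^{1/4}. If Φ_f has an absolutely irreducible factor over F_q, then f is not an o-polynomial of F_q. -/

import Mathlib

open Polynomial

/-- An o-polynomial of a finite field `F`: a polynomial of degree at most `|F| - 1`
inducing a permutation of `F` with `f(0) = 0`, `f(1) = 1`, such that no three points
of the graph of `f` are collinear. -/
def IsOPoly (F : Type*) [Field F] [Finite F] (f : F[X]) : Prop :=
  f.natDegree ≤ Nat.card F - 1 ∧
  Function.Bijective (fun x : F => f.eval x) ∧
  f.eval 0 = 0 ∧ f.eval 1 = 1 ∧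
  ∀ a b c : F, a ≠ b → a ≠ c → b ≠ c →
    Matrix.det !![1, 1, 1; a, b, c; f.eval a, f.eval b, f.eval c] ≠ 0

/-- Two polynomials `f`, `g` are equivalent if
`g(x) = (f(x+a) + f(a)) / (f(1+a) + f(a))` for some `a ∈ F`. -/
def OEquiv (F : Type*) [Field F] (f g : F[X]) : Prop :=
  ∃ a : F, g = Polynomial.C (f.eval (1 + a) + f.eval a)⁻¹ *
    (f.comp (Polynomial.X + Polynomial.C a) + Polynomial.C (f.eval a))

/-- The denominator `(x+y)(x+z)(y+z)` as a polynomial in the variables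
`x = X 0`, `y = X 1`, `z = X 2`. -/
noncomputable def denom (F : Type*) [Field F] : MvPolynomial (Fin 3) F :=
  (MvPolynomial.X 0 + MvPolynomial.X 1) * (MvPolynomial.X 0 + MvPolynomial.X 2) *
    (MvPolynomial.X 1 + MvPolynomial.X 2)

/-- The numerator `x(f(y)+f(z)) + y(f(x)+f(z)) + z(f(x)+f(y))` of `Φ_f`;
`Φ_f` is the (exact) quotient of `numer F f` by `denom F`. -/
noncomputable def numer (F : Type*) [Field F] (f : Polynomial F) : MvPolynomial (Fin 3) F :=
  MvPolynomial.X 0 *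
      (Polynomial.aeval (MvPolynomial.X 1) f + Polynomial.aeval (MvPolynomial.X 2) f) +
    MvPolynomial.X 1 *
      (Polynomial.aeval (MvPolynomial.X 0) f + Polynomial.aeval (MvPolynomial.X 2) f) +
    MvPolynomial.X 2 *
      (Polynomial.aeval (MvPolynomial.X 0) f + Polynomial.aeval (MvPolynomial.X 1) f)

/-- The numerator `x(y^j+z^j) + y(x^j+z^j) + z(x^j+y^j)` of `φ_j`;
`φ_j` is the (exact) quotient of `numerMon F j` by `denom F`. -/
noncomputable def numerMon (F : Type*) [Field F] (j : ℕ) : MvPolynomial (Fin 3) F :=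
  MvPolynomial.X 0 * (MvPolynomial.X 1 ^ j + MvPolynomial.X 2 ^ j) +
    MvPolynomial.X 1 * (MvPolynomial.X 0 ^ j + MvPolynomial.X 2 ^ j) +
    MvPolynomial.X 2 * (MvPolynomial.X 0 ^ j + MvPolynomial.X 1 ^ j)

/-- A polynomial over `F` has an absolutely irreducible factor over `F` if it has a
nonconstant factor with coefficients in `F` that stays irreducible over the algebraic
closure of `F`. -/
def HasAbsIrredFactor (F : Type*) [Field F] (P : MvPolynomial (Fin 3) F) : Prop :=
  ∃ g : MvPolynomial (Fin 3) F, g ∣ P ∧ 0 < g.totalDegree ∧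
    Irreducible (MvPolynomial.map (algebraMap F (AlgebraicClosure F)) g)

theorem natDegree_det_le {R ι : Type*} [CommRing R] [Fintype ι] [DecidableEq ι]
    (M : Matrix ι ι R[X]) (d : ι → ℕ) (hM : ∀ i j, (M i j).natDegree ≤ d j) :
    M.det.natDegree ≤ ∑ j, d j := by
  rw [Matrix.det_apply]
  refine natDegree_sum_le_of_forall_le _ _ fun σ _ => ?_
  refine (natDegree_smul_le _ _).trans ?_
  refine (natDegree_prod_le _ _).trans ?_
  exact Finset.sum_le_sum fun i _ => hM _ _

theorem natDegree_resultant_le {R : Type*} [CommRing R]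
    (f g : R[X][X]) (m n Wf Wg : ℕ) (hf : ∀ c, (f.coeff c).natDegree ≤ Wf)
    (hg : ∀ c, (g.coeff c).natDegree ≤ Wg) :
    (resultant f g m n).natDegree ≤ m * Wg + n * Wf := by
  refine (natDegree_det_le _ (fun j => Fin.addCases (fun _ => Wg) (fun _ => Wf) j) ?_).trans ?_
  · intro i j
    induction j using Fin.addCases with
    | left j => simp only [sylvester, Matrix.of_apply, Fin.addCases_left]; split_ifs <;> simp [hg]
    | right j => simp only [sylvester, Matrix.of_apply, Fin.addCases_right]; split_ifs <;> simp [hf]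
  · rw [Fin.sum_univ_add]; simp

/-- evaluation at `t = τ`, `x = ξ`. -/
noncomputable def psEval {D : Type*} [CommRing D] (ξ : PowerSeries D) : D[X][X] →+* PowerSeries D :=
  eval₂RingHom (coeToPowerSeries.ringHom) ξ

theorem psEval_C {D : Type*} [CommRing D] (ξ : PowerSeries D) (p : D[X]) :
    psEval ξ (C p) = (p : PowerSeries D) := by
  simp [psEval]

theorem psEval_X {D : Type*} [CommRing D] (ξ : PowerSeries D) :
    psEval ξ X = ξ := by
  simp [psEval]

theorem ord_bound {D : Type*} [CommRing D] [IsDomain D] (G u : D[X][X]) (ξ : PowerSeries D)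
    (n W : ℕ) (hn : 0 < n) (hGn : G.natDegree = n)
    (hGd : ∀ c, (G.coeff c).natDegree ≤ n) (hud : u.natDegree ≤ n)
    (huW : ∀ c, (u.coeff c).natDegree ≤ W) (hξ : psEval ξ G = 0)
    (hres : resultant G u n u.natDegree ≠ 0) :
    ∃ i ≤ n * W + n * n, PowerSeries.coeff i (psEval ξ u) ≠ 0 := by
  by_contra! hcon
  obtain ⟨p, r, -, -, e⟩ := exists_mul_add_mul_eq_C_resultant G u (m := n) (n := u.natDegree) hGn.le le_rfl
    (Or.inl hn.ne')
  have h1 := congrArg (psEval ξ) e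
  rw [map_add, map_mul, map_mul, hξ, zero_mul, zero_add, psEval_C] at h1
  have h2 : (resultant G u n u.natDegree).natDegree ≤ n * W + n * n :=
    (natDegree_resultant_le G u n u.natDegree n W hGd huW).trans (by gcongr)
  apply hres
  ext i
  rw [coeff_zero]
  rcases le_or_gt i (n * W + n * n) with hi | hi
  · rw [← Polynomial.coeff_coe, ← h1, PowerSeries.coeff_mul]
    refine Finset.sum_eq_zero fun x hx => ?_
    rw [hcon x.1 (by have := Finset.HasAntidiagonal.mem_antidiagonal.1 hx; omega), zero_mul]
  · exact coeff_eq_zero_of_natDegree_lt (by omega)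

theorem resultant_ne_zero_of_irred {D K : Type*} [CommRing D] [Field K] (φ : D[X] →+* K)
    (hφ : Function.Injective φ) (G u : D[X][X]) (n : ℕ) (hGn : G.natDegree = n)
    (hirr : Irreducible (G.map φ)) (hu : u ≠ 0) (hun : u.natDegree < n) :
    resultant G u n u.natDegree ≠ 0 := by
  intro h0
  have h1 : resultant (G.map φ) (u.map φ) = 0 := by
    rw [natDegree_map_eq_of_injective hφ, natDegree_map_eq_of_injective hφ, resultant_map_map, hGn, h0, map_zero]
  rw [resultant_eq_zero_iff] at h1
  apply h1.2
  rw [hirr.coprime_iff_not_dvd]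
  intro hd
  have := natDegree_le_of_dvd hd (by rwa [Ne, Polynomial.map_eq_zero_iff hφ])
  rw [natDegree_map_eq_of_injective hφ, natDegree_map_eq_of_injective hφ] at this
  omega

/-- the base filtration. -/
def wt0 (R : Type*) [CommRing R] (w : ℤ) : AddSubgroup R := if 0 ≤ w then ⊤ else ⊥

/-- the filtration on `R[X]` in which `X` has weight `M`. -/
def wt {R : Type*} [CommRing R] (M : ℤ) (W : ℤ → AddSubgroup R) (w : ℤ) : AddSubgroup R[X] where
  carrier := {p | ∀ c : ℕ, p.coeff c ∈ W (w - M * c)}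
  zero_mem' := fun c => by simp [(W _).zero_mem]
  add_mem' := fun ha hb c => by rw [coeff_add]; exact (W _).add_mem (ha c) (hb c)
  neg_mem' := fun ha c => by rw [coeff_neg]; exact (W _).neg_mem (ha c)

/-- multiplicativity of a filtration. -/
def WMul {R : Type*} [CommRing R] (W : ℤ → AddSubgroup R) : Prop :=
  (∀ a b x y, x ∈ W a → y ∈ W b → x * y ∈ W (a + b)) ∧ 1 ∈ W 0

theorem wmul_wt0 (R : Type*) [CommRing R] : WMul (wt0 R) := by
  refine ⟨?_, by simp [wt0]⟩
  intro a b x y hx hy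
  unfold wt0 at *
  by_cases ha : 0 ≤ a
  · by_cases hb : 0 ≤ b
    · rw [if_pos (by omega)]; trivial
    · rw [if_neg hb] at hy
      rw [AddSubgroup.mem_bot.1 hy, mul_zero]; exact AddSubgroup.zero_mem _
  · rw [if_neg ha] at hx
    rw [AddSubgroup.mem_bot.1 hx, zero_mul]; exact AddSubgroup.zero_mem _

theorem mem_wt {R : Type*} [CommRing R] {M : ℤ} {W : ℤ → AddSubgroup R} {w : ℤ} {p : R[X]} :
    p ∈ wt M W w ↔ ∀ c : ℕ, p.coeff c ∈ W (w - M * c) := Iff.rfl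

theorem wt_monomial {R : Type*} [CommRing R] {M : ℤ} {W : ℤ → AddSubgroup R} {w : ℤ} {r : R}
    (hr : r ∈ W w) (k : ℕ) : C r * X ^ k ∈ wt M W (w + M * k) := by
  intro c
  rw [coeff_C_mul_X_pow]
  split_ifs with h
  · subst h; simpa using hr
  · exact AddSubgroup.zero_mem _

theorem wt_C {R : Type*} [CommRing R] {M : ℤ} {W : ℤ → AddSubgroup R} {w : ℤ} {r : R}
    (hr : r ∈ W w) : C r ∈ wt M W w := by
  have := wt_monomial (M := M) hr 0
  simpa using this

theorem wmul_wt {R : Type*} [CommRing R] {M : ℤ} {W : ℤ → AddSubgroup R} (h : WMul W) :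
    WMul (wt M W) := by
  refine ⟨?_, by rw [← C_1]; exact wt_C h.2⟩
  intro a b x y hx hy c
  rw [coeff_mul]
  refine AddSubgroup.sum_mem _ fun i hi => ?_
  have hi := Finset.HasAntidiagonal.mem_antidiagonal.1 hi
  have := h.1 _ _ _ _ (hx i.1) (hy i.2)
  have e : a - M * i.1 + (b - M * i.2) = a + b - M * c := by rw [← hi]; push_cast; ring
  rwa [e] at this

theorem WMul.pow {R : Type*} [CommRing R] {W : ℤ → AddSubgroup R} (h : WMul W) {a : ℤ} {x : R}
    (hx : x ∈ W a) (k : ℕ) : x ^ k ∈ W (k * a) := by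
  induction k with
  | zero => simpa using h.2
  | succ k ih =>
    have := h.1 _ _ _ _ ih hx
    have e : (k : ℤ) * a + a = ((k + 1 : ℕ) : ℤ) * a := by push_cast; ring
    rw [e] at this; rwa [pow_succ]

theorem wt_X {R : Type*} [CommRing R] {M : ℤ} {W : ℤ → AddSubgroup R} (h : WMul W) :
    X ∈ wt M W M := by
  have := wt_monomial (M := M) h.2 1
  simpa using this

theorem wt_divMod {R : Type*} [CommRing R] [Nontrivial R] {M : ℤ} {W : ℤ → AddSubgroup R} (h : WMul W)
    (q : R[X]) (hq : q.Monic) (hqw : q ∈ wt M W (M * q.natDegree)) (w : ℤ) (p : R[X])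
    (hp : p ∈ wt M W w) : p /ₘ q ∈ wt M W (w - M * q.natDegree) ∧ p %ₘ q ∈ wt M W w := by
  induction hN : p.natDegree using Nat.strong_induction_on generalizing p with
  | _ N ih =>
  by_cases hd : p.degree < q.degree
  · rw [(modByMonic_eq_self_iff hq).2 hd, (divByMonic_eq_zero_iff hq).2 hd]
    exact ⟨AddSubgroup.zero_mem _, hp⟩
  by_cases hp0 : p = 0
  · subst hp0; simp [AddSubgroup.zero_mem]
  have hd' : q.degree ≤ p.degree := not_lt.1 hd
  have hle : q.natDegree ≤ p.natDegree := natDegree_le_natDegree hd'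
  set m : R[X] := C p.leadingCoeff * X ^ (p.natDegree - q.natDegree) with hm
  have hmw : m ∈ wt M W (w - M * q.natDegree) := by
    have := wt_monomial (M := M) (hp p.natDegree) (p.natDegree - q.natDegree)
    have e : w - M * p.natDegree + M * ((p.natDegree - q.natDegree : ℕ) : ℤ) = w - M * q.natDegree := by
      push_cast [hle]; ring
    rwa [e] at this
  have hlt : (p - q * m).degree < p.degree := by
    have := div_wf_lemma ⟨hd', hp0⟩ hq
    exact this
  have hp' : p - q * m ∈ wt M W w := by
    refine AddSubgroup.sub_mem _ hp ?_
    have := (wmul_wt (M := M) h).1 _ _ _ _ hqw hmw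
    have e : M * q.natDegree + (w - M * q.natDegree) = w := by ring
    rwa [e] at this
  have key : (p - q * m) /ₘ q ∈ wt M W (w - M * q.natDegree) ∧ (p - q * m) %ₘ q ∈ wt M W w := by
    by_cases hz : p - q * m = 0
    · rw [hz]; simp [AddSubgroup.zero_mem]
    · refine ih _ ?_ _ hp' rfl
      rw [← hN]; exact natDegree_lt_natDegree hz hlt
  have hu := div_modByMonic_unique ((p - q * m) /ₘ q + m) ((p - q * m) %ₘ q) (f := p) hq
    ⟨by have := modByMonic_add_div (p - q * m) q
        linear_combination this, degree_modByMonic_lt _ hq⟩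
  rw [hu.1, hu.2]
  exact ⟨AddSubgroup.add_mem _ key.1 hmw, key.2⟩

theorem mem_wt1 {R : Type*} [CommRing R] {w : ℤ} {p : R[X]} :
    p ∈ wt 1 (wt0 R) w ↔ ∀ c : ℕ, p.coeff c ≠ 0 → (c : ℤ) ≤ w := by
  rw [mem_wt]
  refine forall_congr' fun c => ?_
  unfold wt0
  by_cases hc : (0:ℤ) ≤ w - 1 * c
  · rw [if_pos hc]; simp; intro _; omega
  · rw [if_neg hc, AddSubgroup.mem_bot]
    constructor
    · intro h h'; exact absurd h h'
    · intro h; by_contra h'; have := h h'; omega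

theorem wt0_mono (R : Type*) [CommRing R] : Monotone (wt0 R) := by
  intro a b hab x hx
  unfold wt0 at *
  by_cases ha : 0 ≤ a
  · rw [if_pos (by omega)]; trivial
  · rw [if_neg ha] at hx
    rw [AddSubgroup.mem_bot.1 hx]; exact AddSubgroup.zero_mem _

theorem wt_mono {R : Type*} [CommRing R] {M : ℤ} {W : ℤ → AddSubgroup R} (h : Monotone W) :
    Monotone (wt M W) := by
  intro a b hab x hx c
  exact h (by omega) (hx c)

/-- the total degree filtration on `R[t][x]`. -/
noncomputable abbrev W2 (R : Type*) [CommRing R] : ℤ → AddSubgroup R[X][X] := wt 1 (wt 1 (wt0 R))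

theorem wmul_W2 (R : Type*) [CommRing R] : WMul (W2 R) := wmul_wt (wmul_wt (wmul_wt0 R))

theorem W2_mono (R : Type*) [CommRing R] : Monotone (W2 R) := wt_mono (wt_mono (wt0_mono R))

theorem mem_W2 {R : Type*} [CommRing R] {w : ℤ} {p : R[X][X]} :
    p ∈ W2 R w ↔ ∀ c d : ℕ, (p.coeff c).coeff d ≠ 0 → (d : ℤ) + c ≤ w := by
  rw [mem_wt]
  refine forall_congr' fun c => ?_
  rw [mem_wt1]
  refine forall_congr' fun d => ?_
  refine imp_congr_right fun _ => ?_
  constructor <;> intro <;> omega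

/-- the index set `l < n`, `i + l ≤ a`, pairs `(i, l)`. -/
def Tset (n a : ℕ) : Finset (ℕ × ℕ) :=
  (Finset.range (a + 1) ×ˢ Finset.range n).filter fun p => p.1 + p.2 ≤ a

theorem mem_Tset {n a : ℕ} {p : ℕ × ℕ} : p ∈ Tset n a ↔ p.2 < n ∧ p.1 + p.2 ≤ a := by
  simp only [Tset, Finset.mem_filter, Finset.mem_product, Finset.mem_range]
  omega

theorem sum_sub_aux (A m : ℕ) (hm : m ≤ A + 1) :
    2 * (∑ j ∈ Finset.range m, ((A - j : ℕ) : ℤ)) = m * (2 * A - m + 1) := by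
  induction m with
  | zero => simp
  | succ m ih =>
    rw [Finset.sum_range_succ, mul_add, ih (by omega)]
    push_cast [show m ≤ A by omega]
    ring

theorem card_Tset (n a : ℕ) (hn : n ≤ a + 1) : 2 * ((Tset n a).card : ℤ) = n * (2 * a + 3 - n) := by
  have : (Tset n a).card = ∑ j ∈ Finset.range n, (a + 1 - j) := by
    have h : Tset n a = (Finset.range n).biUnion fun l => (Finset.range (a + 1 - l)).image fun i => (i, l) := by
      ext ⟨i, l⟩
      simp only [mem_Tset, Finset.mem_biUnion, Finset.mem_image, Finset.mem_range, Prod.mk.injEq]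
      constructor
      · rintro ⟨h1, h2⟩; exact ⟨l, h1, i, by omega, rfl, rfl⟩
      · rintro ⟨l', h1, i', h2, rfl, rfl⟩; omega
    rw [h, Finset.card_biUnion]
    · refine Finset.sum_congr rfl fun l _ => ?_
      rw [Finset.card_image_of_injective _ (fun x y hxy => (Prod.mk.inj hxy).1), Finset.card_range]
    · intro l _ l' _ hll
      rw [Function.onFun, Finset.disjoint_left]
      rintro ⟨i, j⟩ h1 h2
      simp only [Finset.mem_image, Finset.mem_range, Prod.mk.injEq] at h1 h2
      obtain ⟨_, _, _, rfl⟩ := h1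
      obtain ⟨_, _, _, rfl⟩ := h2
      exact hll rfl
  rw [this]
  push_cast
  rw [sum_sub_aux _ _ (by omega)]
  push_cast; ring

/-- index set of equations. -/
def Eset (n M : ℕ) : Finset (Σ _ : ℕ × ℕ, ℕ) :=
  (Finset.range (n - 1) ×ˢ Finset.range n).sigma fun p => Finset.range (M * (2 * n + 1 - p.1) - p.2)

theorem card_Eset (n M : ℕ) (hn : 1 ≤ n) (hM : n ^ 2 ≤ M) :
    2 * ((Eset n M).card : ℤ) = n * (n - 1) * (M * (3 * n + 4) - (n - 1)) := by
  have hnM : n ≤ M := by nlinarith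
  have key : ∀ m ≤ n, 2 * (∑ l ∈ Finset.range m, ∑ j ∈ Finset.range n, ((M * (2 * n + 1 - l) - j : ℕ) : ℤ))
      = n * m * (2 * M * (2 * n + 1) - (n - 1) - M * (m - 1)) := by
    intro m hm
    induction m with
    | zero => simp
    | succ m ih =>
      rw [Finset.sum_range_succ, mul_add, ih (by omega), sum_sub_aux]
      · push_cast [show m ≤ 2 * n + 1 by omega]
        ring
      · have : 1 ≤ 2 * n + 1 - m := by omega
        have := Nat.mul_le_mul_left M this
        omega
  have h := key (n - 1) (by omega)
  rw [Eset, Finset.card_sigma, Finset.sum_product]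
  simp only [Finset.card_range]
  push_cast
  rw [h]
  push_cast [hn]
  ring

theorem card_lt (n M : ℕ) (hn : 1 ≤ n) (hM : n ^ 2 ≤ M) :
    (Eset n M).card < (Tset n (2 * n)).card * (Tset n (M - 1)).card := by
  have hnM : n ≤ M := by nlinarith
  have h1 := card_Eset n M hn hM
  have h2 := card_Tset n (2 * n) (by omega)
  have h3 := card_Tset n (M - 1) (by omega)
  push_cast [show 1 ≤ M by omega] at h2 h3
  have : (4 * (Eset n M).card : ℤ) < 4 * ((Tset n (2 * n)).card * (Tset n (M - 1)).card) := by
    have e1 : (4 * (Eset n M).card : ℤ) = 2 * (n * (n - 1) * (M * (3 * n + 4) - (n - 1))) := by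
      rw [← h1]; ring
    have e2 : (4 * ((Tset n (2 * n)).card * (Tset n (M - 1)).card) : ℤ)
      = (n * (2 * (2 * n) + 3 - n)) * (n * (2 * (M - 1) + 3 - n)) := by
      rw [← h2, ← h3]; ring
    rw [e1, e2]
    have hn' : (1 : ℤ) ≤ n := by exact_mod_cast hn
    have hM' : (n : ℤ) ^ 2 ≤ M := by exact_mod_cast hM
    have : 0 < (M : ℤ) * (4 * n + 8) - 3 * n ^ 3 + 3 * n + 2 * (n - 1) ^ 2 := by
      nlinarith [sq_nonneg ((n : ℤ) - 1), mul_nonneg (sub_nonneg.2 hM') (by linarith : (0:ℤ) ≤ 4 * n + 8), pow_pos (by linarith : (0:ℤ) < n) 3]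
    nlinarith [mul_pos (by linarith : (0:ℤ) < n) this]
  have h4 : (4:ℤ) * ((Eset n M).card : ℤ) < 4 * (((Tset n (2 * n)).card * (Tset n (M - 1)).card : ℕ) : ℤ) := by
    push_cast; exact this
  have h5 := lt_of_mul_lt_mul_left h4 (by norm_num)
  exact_mod_cast h5

/-- evaluation in `t = t0`, `x = x0`. -/
noncomputable def ev2 {F K : Type*} [CommRing F] [CommRing K] (φ : F →+* K) (t0 x0 : K) : F[X][X] →+* K :=
  eval₂RingHom (eval₂RingHom φ t0) x0

/-- monomials of the Stepanov auxiliary polynomial. -/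
noncomputable def stMon (F : Type*) [Field F] (M : ℕ) (p : (ℕ × ℕ) × (ℕ × ℕ)) : F[X][X][X] :=
  C (C (C 1 * X ^ (M * p.1.1 + p.2.1)) * X ^ p.2.2) * X ^ p.1.2

theorem stMon_smul {F : Type*} [Field F] (M : ℕ) (p : (ℕ × ℕ) × (ℕ × ℕ)) (r : F) :
    r • stMon F M p = C (C (C r * X ^ (M * p.1.1 + p.2.1)) * X ^ p.2.2) * X ^ p.1.2 := by
  rw [Algebra.smul_def, stMon]
  have : algebraMap F F[X][X][X] r = C (C (C r)) := rfl
  rw [this]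
  simp only [map_mul, map_pow, map_one]
  ring

/-- the doubly reduced coefficient -/
noncomputable def redL (F : Type*) [Field F] (G : F[X][X]) (Ψ : F[X][X][X]) (l j : ℕ) : F[X][X][X] →ₗ[F] F[X] :=
  ((lcoeff F[X] j).restrictScalars F) ∘ₗ ((modByMonicHom G).restrictScalars F) ∘ₗ
    ((lcoeff F[X][X] l).restrictScalars F) ∘ₗ ((modByMonicHom Ψ).restrictScalars F)

theorem redL_apply {F : Type*} [Field F] (G : F[X][X]) (Ψ : F[X][X][X]) (l j : ℕ) (p : F[X][X][X]) :
    redL F G Ψ l j p = (((p %ₘ Ψ).coeff l) %ₘ G).coeff j := rfl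

theorem stepanov_exists {F K : Type*} [Field F] [Field K] (φ : F →+* K) (G H : F[X][X]) (n M : ℕ) (hn : 1 ≤ n)
    (hM : n ^ 2 ≤ M) (hG : G.Monic) (hGn : G.natDegree = n) (hGw : G ∈ W2 F n)
    (hH : H.Monic) (hHn : H.natDegree = n) (hHw : ∀ c : ℕ, H.coeff c ∈ wt 1 (wt0 F) (M * n - M * c)) :
    ∃ e : (ℕ × ℕ) × (ℕ × ℕ) → F, (∃ p ∈ Tset n (2 * n) ×ˢ Tset n (M - 1), e p ≠ 0) ∧
      ∀ (t0 x1 z1 : K), ev2 φ t0 x1 G = 0 → ev2 φ t0 z1 H = 0 →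
        ev2 φ t0 (x1 ^ M) H = 0 → z1 ≠ x1 ^ M → 
        ∑ p ∈ Tset n (2 * n) ×ˢ Tset n (M - 1),
          φ (e p) * t0 ^ (M * p.1.1 + p.2.1) * x1 ^ p.2.2 * z1 ^ p.1.2 = 0 := by
  have hM1 : 1 ≤ M := by nlinarith
  set P : F[X][X] := X ^ M with hP
  set H' : F[X][X][X] := H.map C with hH'
  set Ψ : F[X][X][X] := H' /ₘ (X - C P) with hΨ
  have hW2 := wmul_W2 F
  have hPw : P ∈ W2 F M := by
    have := hW2.pow (wt_X (M := 1) (wmul_wt (M := 1) (wmul_wt0 F))) M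
    simpa using this
  have hLw : X - C P ∈ wt (M : ℤ) (W2 F) (M * (X - C P).natDegree) := by
    rw [natDegree_X_sub_C]
    push_cast
    rw [mul_one]
    exact AddSubgroup.sub_mem _ (wt_X hW2) (wt_C hPw)
  have hH'w : H' ∈ wt (M : ℤ) (W2 F) (M * n) := by
    intro c
    rw [hH', coeff_map]
    exact wt_C (hHw c)
  have hΨw0 := (wt_divMod hW2 (X - C P) (monic_X_sub_C P) hLw _ H' hH'w).1
  rw [← hΨ, natDegree_X_sub_C] at hΨw0
  have hH'm : H'.Monic := hH.map C
  have hH'n : H'.natDegree = n := by rw [hH', hH.natDegree_map, hHn]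
  have hdl : (X - C P).degree ≤ H'.degree := by
    rw [degree_X_sub_C, degree_eq_natDegree hH'm.ne_zero, hH'n]; exact_mod_cast hn
  have hΨm : Ψ.Monic := by
    rw [Monic, hΨ, leadingCoeff_divByMonic_of_monic (monic_X_sub_C P) hdl]; exact hH'm
  have hΨn : Ψ.natDegree = n - 1 := by
    rw [hΨ, natDegree_divByMonic _ (monic_X_sub_C P), hH'n, natDegree_X_sub_C]
  have hΨw : Ψ ∈ wt (M : ℤ) (W2 F) (M * Ψ.natDegree) := by
    have e1 : (M : ℤ) * ((n - 1 : ℕ) : ℤ) = M * n - M * ((1 : ℕ) : ℤ) := by push_cast [hn]; ring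
    rw [hΨn, e1]; exact hΨw0
  set S := Tset n (2 * n) ×ˢ Tset n (M - 1) with hS
  let L : (S → F) →ₗ[F] (Eset n M → F) :=
    LinearMap.pi fun y => (lcoeff F y.1.2) ∘ₗ (redL F G Ψ y.1.1.1 y.1.1.2) ∘ₗ
      (Fintype.linearCombination F (fun p : S => stMon F M p.1))
  have hker : LinearMap.ker L ≠ ⊥ := by
    apply LinearMap.ker_ne_bot_of_finrank_lt
    rw [Module.finrank_fintype_fun_eq_card, Module.finrank_fintype_fun_eq_card, Fintype.card_coe, Fintype.card_coe, hS,
      Finset.card_product]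
    exact card_lt n M hn hM
  obtain ⟨e, heL, he0⟩ := (Submodule.ne_bot_iff _).1 hker
  rw [LinearMap.mem_ker] at heL
  set A : F[X][X][X] := Fintype.linearCombination F (fun p : S => stMon F M p.1) e with hA
  have hAsum : A = ∑ p : S, e p • stMon F M p.1 := by rw [hA, Fintype.linearCombination_apply]
  have hAw : A ∈ wt (M : ℤ) (W2 F) (M * (2 * n) + (M - 1)) := by
    rw [hAsum]
    refine AddSubgroup.sum_mem _ fun p _ => ?_
    have hp : p.1 ∈ Tset n (2 * n) ×ˢ Tset n (M - 1) := p.2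
    rw [Finset.mem_product, mem_Tset, mem_Tset] at hp
    have hm : e p • stMon F M p.1 = C (C (C (e p) * X ^ (M * p.1.1.1 + p.1.2.1)) * X ^ p.1.2.2) * X ^ p.1.1.2 := by
      exact stMon_smul M p.1 (e p)
    rw [hm]
    have h0 : e p ∈ wt0 F 0 := by simp [wt0]
    have := wt_monomial (M := (M : ℤ)) (wt_monomial (M := 1) (wt_monomial (M := 1) h0 (M * p.1.1.1 + p.1.2.1)) p.1.2.2) p.1.1.2
    refine wt_mono (W2_mono F) ?_ this
    obtain ⟨⟨_, h1⟩, _, h2⟩ := hp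
    have h2' : p.1.2.1 + p.1.2.2 + 1 ≤ M := by omega
    push_cast
    have h1' : (p.1.1.1 : ℤ) + p.1.1.2 ≤ 2 * n := by exact_mod_cast h1
    have h2'' : (p.1.2.1 : ℤ) + p.1.2.2 + 1 ≤ M := by exact_mod_cast h2'
    nlinarith [mul_le_mul_of_nonneg_left h1' (Int.natCast_nonneg M)]
  have hred0 : ∀ l j, redL F G Ψ l j A = 0 := by
    intro l j
    by_cases hl : l < n - 1
    · by_cases hj : j < n
      · ext c
        rw [coeff_zero]
        by_cases hc : c < M * (2 * n + 1 - l) - j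
        · have := congrFun heL ⟨⟨(l, j), c⟩, by
            simp only [Eset, Finset.mem_sigma, Finset.mem_product, Finset.mem_range]
            exact ⟨⟨hl, hj⟩, hc⟩⟩
          exact this
        · have h1 := (wt_divMod hW2 Ψ hΨm hΨw _ A hAw).2 l
          have h2 := (wt_divMod (wmul_wt (wmul_wt0 F)) G hG (by rw [hGn, one_mul]; exact hGw) _ _ h1).2 j
          rw [mem_wt1] at h2
          by_contra h3
          have h4 := h2 c h3
          apply hc
          have h5 : (c : ℤ) + j < M * (2 * n + 1 - l) := by linarith
          have h6 : c + j < M * (2 * n + 1 - l) := by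
            zify [show l ≤ 2 * n + 1 by omega]; exact h5
          omega
      · rw [redL_apply]
        apply coeff_eq_zero_of_natDegree_lt
        refine (natDegree_modByMonic_lt _ hG ?_).trans_le (by omega)
        intro h; rw [h, natDegree_one] at hGn; omega
    · rw [redL_apply]
      have : (A %ₘ Ψ).coeff l = 0 := by
        by_cases h1 : Ψ = 1
        · rw [h1, modByMonic_one, coeff_zero]
        apply coeff_eq_zero_of_natDegree_lt
        exact (natDegree_modByMonic_lt _ hΨm h1).trans_le (by omega)
      rw [this, zero_modByMonic, coeff_zero]
  have hdiv : ∀ l, G ∣ (A %ₘ Ψ).coeff l := by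
    intro l
    rw [← modByMonic_eq_zero_iff_dvd hG]
    ext1 j
    exact hred0 l j
  refine ⟨fun p => if h : p ∈ S then e ⟨p, h⟩ else 0, ?_, ?_⟩
  · obtain ⟨p, hp⟩ := Function.ne_iff.1 he0
    exact ⟨p.1, p.2, by simpa using hp⟩
  · intro t0 x1 z1 hG0 hH0 hH1 hz
    let ev3 : F[X][X][X] →+* K := eval₂RingHom (ev2 φ t0 x1) z1
    have hev3 : ∀ p, ev3 p = eval₂ (ev2 φ t0 x1) z1 p := fun p => rfl
    have hcomp : (ev2 φ t0 x1).comp C = eval₂RingHom φ t0 := by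
      ext <;> simp [ev2]
    have hH'0 : ev3 H' = 0 := by
      rw [hev3, hH', eval₂_map, hcomp]; exact hH0
    have hP0 : ev2 φ t0 x1 P = x1 ^ M := by
      rw [hP, map_pow, ev2, coe_eval₂RingHom, eval₂_X]
    have hHP : ev2 φ t0 x1 (H'.eval P) = 0 := by
      rw [hH', eval_map, hom_eval₂, hcomp, hP0]; exact hH1
    have hΨ0 : ev3 Ψ = 0 := by
      have h1 := modByMonic_add_div H' (X - C P)
      rw [modByMonic_X_sub_C_eq_C_eval, ← hΨ] at h1
      have h2 := congrArg ev3 h1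
      have h3 : ev3 (X - C P) = z1 - x1 ^ M := by rw [hev3, eval₂_sub, eval₂_X, eval₂_C, hP0]
      rw [map_add, map_mul, h3, hH'0, hev3 (C _), eval₂_C, hHP, zero_add] at h2
      exact (mul_eq_zero.1 h2).resolve_left (sub_ne_zero.2 hz)
    have hA0 : ev3 A = 0 := by
      rw [← modByMonic_add_div A Ψ, map_add, map_mul, hΨ0, zero_mul, add_zero, hev3, eval₂_eq_sum_range]
      refine Finset.sum_eq_zero fun l _ => ?_
      obtain ⟨y, hy⟩ := hdiv l
      rw [hy, map_mul, hG0, zero_mul, zero_mul]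
    rw [← Finset.sum_coe_sort S, ← hA0, hAsum, map_sum]
    refine Finset.sum_congr rfl fun p _ => ?_
    simp only [dif_pos p.2]
    have hm : e p • stMon F M p.1 = C (C (C (e p) * X ^ (M * p.1.1.1 + p.1.2.1)) * X ^ p.1.2.2) * X ^ p.1.1.2 := by
      exact stMon_smul M p.1 (e p)
    rw [hm, hev3]
    simp only [eval₂_mul, eval₂_C, eval₂_pow, eval₂_X, eval₂_X_pow, ev2, coe_eval₂RingHom]

theorem mem_range_of_pow_card {F K : Type*} [Field F] [Fintype F] [Field K] (φ : F →+* K) (x : K)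
    (hx : x ^ Fintype.card F = x) : ∃ y, φ y = x := by
  classical
  by_contra hcon
  push Not at hcon
  set p : K[X] := X ^ Fintype.card F - X with hp
  have hq : 1 < Fintype.card F := Fintype.one_lt_card
  have hdeg : p.natDegree = Fintype.card F := FiniteField.X_pow_card_sub_X_natDegree_eq K hq
  have hp0 : p ≠ 0 := FiniteField.X_pow_card_sub_X_ne_zero K hq
  have hsub : insert x (Finset.univ.image φ) ⊆ p.roots.toFinset := by
    intro y hy
    rw [Multiset.mem_toFinset, mem_roots hp0, IsRoot.def, hp, eval_sub, eval_pow, eval_X, sub_eq_zero]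
    rcases Finset.mem_insert.1 hy with rfl | hy
    · exact hx
    · obtain ⟨z, -, rfl⟩ := Finset.mem_image.1 hy
      rw [← map_pow, FiniteField.pow_card]
  have h1 := Finset.card_le_card hsub
  rw [Finset.card_insert_of_notMem, Finset.card_image_of_injective _ φ.injective, Finset.card_univ] at h1
  · have h2 := Multiset.toFinset_card_le p.roots
    have h3 := card_roots' p
    omega
  · intro h
    obtain ⟨z, -, hz⟩ := Finset.mem_image.1 h
    exact hcon z hz

theorem ev2_apply {F K : Type*} [CommRing F] [CommRing K] (φ : F →+* K) (t0 x0 : K) (p : F[X][X]) :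
    ev2 φ t0 x0 p = eval₂ (eval₂RingHom φ t0) x0 p := rfl

theorem ev2_frob {F K : Type*} [Field F] [Field K] [CharP F 2] [CharP K 2] (φ : F →+* K) (t0 y : K) (μ : ℕ) (G : F[X][X]) :
    ev2 φ t0 (y ^ 2 ^ μ) (G.map (iterateFrobenius F[X] 2 μ)) = (ev2 φ t0 y G) ^ 2 ^ μ := by
  rw [ev2_apply, ev2_apply, eval₂_map, ← iterateFrobenius_def, ← iterateFrobenius_def, hom_eval₂]
  congr 1
  refine RingHom.ext fun r => ?_
  simp only [RingHom.comp_apply, iterateFrobenius_def, map_pow]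

theorem ev2_frob_rat {F K : Type*} [Field F] [Fintype F] [Field K] [CharP F 2] [CharP K 2] (φ : F →+* K) (t0 : F) (y : K)
    (h : ℕ) (hq : Fintype.card F = 2 ^ h) (G : F[X][X]) :
    ev2 φ (φ t0) (y ^ 2 ^ h) G = (ev2 φ (φ t0) y G) ^ 2 ^ h := by
  rw [ev2_apply, ev2_apply, ← iterateFrobenius_def, ← iterateFrobenius_def, hom_eval₂]
  congr 1
  refine RingHom.ext fun r => ?_
  simp only [RingHom.comp_apply, iterateFrobenius_def, coe_eval₂RingHom, eval₂_at_apply]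
  rw [← map_pow, ← hq, FiniteField.pow_card]

/-- the auxiliary polynomial -/
noncomputable def stB {F : Type*} [CommRing F] (Q : ℕ) (S : Finset ((ℕ × ℕ) × (ℕ × ℕ))) (e : (ℕ × ℕ) × (ℕ × ℕ) → F) : F[X][X] :=
  ∑ p ∈ S, C (C (e p) * X ^ (p.1.1 + Q * p.2.1)) * X ^ (p.1.2 + Q * p.2.2)

theorem stB_wt {F : Type*} [Field F] (Q n a b : ℕ) (e : (ℕ × ℕ) × (ℕ × ℕ) → F) :
    stB Q (Tset n a ×ˢ Tset n b) e ∈ W2 F (a + Q * b) := by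
  refine AddSubgroup.sum_mem _ fun p hp => ?_
  rw [Finset.mem_product, mem_Tset, mem_Tset] at hp
  have h0 : e p ∈ wt0 F 0 := by simp [wt0]
  have := (wt_monomial (M := 1) (wt_monomial (M := 1) h0 (p.1.1 + Q * p.2.1)) (p.1.2 + Q * p.2.2))
  refine W2_mono F ?_ this
  obtain ⟨⟨_, h1⟩, _, h2⟩ := hp
  have h3 := Nat.mul_le_mul_left Q h2
  push_cast
  zify at h1 h3
  linarith

theorem stepanov_vanish {F K : Type*} [Field F] [Fintype F] [CharP F 2] [Field K] [IsAlgClosed K] [Algebra F K]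
    (h μ n : ℕ) (hq : Fintype.card F = 2 ^ h) (hμ : μ ≤ h) (hn : 1 ≤ n) (hM : n ^ 2 ≤ 2 ^ μ)
    (G : F[X][X]) (hG : G.Monic) (hGn : G.natDegree = n) (hGw : G ∈ W2 F n)
    (T : Finset F) (hT : ∀ t ∈ T, (G.map (evalRingHom t)).Separable ∧ ∀ x, (G.map (evalRingHom t)).eval x ≠ 0)
    (hTc : 2 * n + 2 ^ (h - μ) * (2 ^ μ - 1) < T.card) :
    ∃ e : (ℕ × ℕ) × (ℕ × ℕ) → F, (∃ p ∈ Tset n (2 * n) ×ˢ Tset n (2 ^ μ - 1), e p ≠ 0) ∧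
      G ∣ stB (2 ^ (h - μ)) (Tset n (2 * n) ×ˢ Tset n (2 ^ μ - 1)) e := by
  classical
  set φ : F →+* K := algebraMap F K with hφ
  haveI : CharP K 2 := charP_of_injective_algebraMap φ.injective 2
  set H := G.map (iterateFrobenius F[X] 2 μ) with hH
  have hHw : ∀ c : ℕ, H.coeff c ∈ wt 1 (wt0 F) (((2 ^ μ : ℕ) : ℤ) * n - (2 ^ μ : ℕ) * c) := by
    intro c
    rw [hH, coeff_map, iterateFrobenius_def]
    have := (wmul_wt (M := 1) (wmul_wt0 F)).pow (hGw c) (2 ^ μ)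
    have e : ((2 ^ μ : ℕ) : ℤ) * (n - 1 * c) = ((2 ^ μ : ℕ) : ℤ) * n - (2 ^ μ : ℕ) * c := by ring
    rwa [e] at this
  obtain ⟨e, he0, he⟩ := stepanov_exists φ G H n (2 ^ μ) hn hM hG hGn hGw (hG.map _)
    (by rw [hH, hG.natDegree_map, hGn]) hHw
  set S := Tset n (2 * n) ×ˢ Tset n (2 ^ μ - 1) with hS
  set e' : (ℕ × ℕ) × (ℕ × ℕ) → F := fun p => (iterateFrobeniusEquiv F 2 μ).symm (e p) with he'
  have hee : ∀ p, e' p ^ 2 ^ μ = e p := by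
    intro p
    rw [← iterateFrobeniusEquiv_def]
    exact RingEquiv.apply_symm_apply _ _
  refine ⟨e', ?_, ?_⟩
  · obtain ⟨p, hp, hp0⟩ := he0
    exact ⟨p, hp, fun h0 => hp0 (by rw [← hee, h0]; simp)⟩
  set B := stB (2 ^ (h - μ)) S e' with hB
  have hQM : 2 ^ μ * 2 ^ (h - μ) = 2 ^ h := by rw [← pow_add]; congr 1; omega
  have hvan : ∀ t ∈ T, ∀ x : K, ev2 φ (φ t) x G = 0 → ev2 φ (φ t) x B = 0 := by
    intro t ht x hx
    have hxF : x ^ 2 ^ h ≠ x := by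
      intro hxx
      obtain ⟨y, rfl⟩ := mem_range_of_pow_card φ x (by rw [hq]; exact hxx)
      apply (hT t ht).2 y
      have : φ ((G.map (evalRingHom t)).eval y) = ev2 φ (φ t) (φ y) G := by
        rw [ev2_apply, eval_map, hom_eval₂]
        congr 1
        refine RingHom.ext fun r => ?_
        simp
      rw [hx] at this
      exact (map_eq_zero φ).1 this
    have hpow : (ev2 φ (φ t) x B) ^ 2 ^ μ = 0 := by
      rw [← he (φ t) (x ^ 2 ^ h) (x ^ 2 ^ μ) (by rw [ev2_frob_rat φ t x h hq, hx]; simp)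
        (by rw [hH, ev2_frob, hx]; simp) (by rw [hH, ev2_frob, ev2_frob_rat φ t x h hq, hx]; simp) ?_]
      · rw [hB, stB, map_sum, ← iterateFrobenius_def, map_sum]
        refine Finset.sum_congr rfl fun p _ => ?_
        rw [iterateFrobenius_def, ← hee p, ev2_apply]
        simp only [eval₂_mul, eval₂_C, eval₂_pow, eval₂_X, coe_eval₂RingHom, mul_pow, map_pow]
        have ht' : ∀ k, (φ t) ^ (2 ^ h * k) = (φ t) ^ k := by
          intro k; rw [pow_mul, ← map_pow, ← hq, FiniteField.pow_card]
        have e1 : ((φ t) ^ (p.1.1 + 2 ^ (h - μ) * p.2.1)) ^ 2 ^ μ = φ t ^ (2 ^ μ * p.1.1 + p.2.1) := by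
          rw [← pow_mul, pow_add, ← ht' p.2.1, ← pow_add]
          congr 1
          rw [← hQM]; ring
        have e2 : (x ^ (p.1.2 + 2 ^ (h - μ) * p.2.2)) ^ 2 ^ μ = (x ^ 2 ^ h) ^ p.2.2 * (x ^ 2 ^ μ) ^ p.1.2 := by
          rw [← pow_mul, ← pow_mul, ← pow_mul, ← pow_add]
          congr 1
          rw [← hQM]; ring
        rw [e1, e2]; ring
      · intro h1
        apply hxF
        have : iterateFrobenius K 2 μ x = iterateFrobenius K 2 μ (x ^ 2 ^ h) := by
          rw [iterateFrobenius_def, iterateFrobenius_def, h1]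
        exact ((iterateFrobenius K 2 μ).injective this).symm
    exact pow_eq_zero_iff (by positivity) |>.1 hpow
  rw [← modByMonic_eq_zero_iff_dvd hG]
  set r := B %ₘ G with hr
  have hrw : r ∈ W2 F (((2 * n : ℕ) : ℤ) + (2 ^ (h - μ) : ℕ) * (2 ^ μ - 1 : ℕ)) :=
    (wt_divMod (wmul_wt (wmul_wt0 F)) G hG (by rw [hGn, one_mul]; exact hGw) _ _ (stB_wt _ _ _ _ _)).2
  have hG1 : G ≠ 1 := by
    intro h; rw [h, natDegree_one] at hGn; omega
  have hrt : ∀ t ∈ T, r.map (evalRingHom t) = 0 := by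
    intro t ht
    have hsep := (hT t ht).1
    have hgn : (G.map (evalRingHom t)).natDegree = n := by rw [hG.natDegree_map, hGn]
    have hcard := card_rootSet_eq_natDegree (K := K) hsep (IsAlgClosed.splits _)
    rw [hgn] at hcard
    rw [← Polynomial.map_eq_zero_iff φ.injective]
    have hrr : ∀ (p : F[X][X]) (x : K), eval x ((p.map (evalRingHom t)).map φ) = ev2 φ (φ t) x p := by
      intro p x
      rw [ev2_apply, eval_map, eval₂_map]
      congr 1
      refine RingHom.ext fun r => ?_
      simp
    apply eq_zero_of_natDegree_lt_card_of_eval_eq_zero' _ ((G.map (evalRingHom t)).rootSet K).toFinset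
    · intro x hx
      rw [Set.mem_toFinset, mem_rootSet] at hx
      have hx0 : ev2 φ (φ t) x G = 0 := by
        rw [← hrr, eval_map]; exact hx.2
      rw [hrr]
      have := modByMonic_add_div B G
      have h2 := congrArg (ev2 φ (φ t) x) this
      rw [map_add, map_mul, hx0, zero_mul, add_zero, hvan t ht x hx0] at h2
      exact h2
    · rw [Set.toFinset_card, hcard]
      refine (natDegree_map_le).trans_lt (natDegree_map_le.trans_lt ?_)
      rw [← hGn]
      exact natDegree_modByMonic_lt _ hG hG1
  ext1 j
  rw [coeff_zero]
  apply eq_zero_of_natDegree_lt_card_of_eval_eq_zero' _ T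
  · intro t ht
    have := congrArg (fun p => p.coeff j) (hrt t ht)
    simpa using this
  · refine lt_of_le_of_lt ?_ hTc
    rw [natDegree_le_iff_coeff_eq_zero]
    intro c hc
    by_contra h0
    have := mem_W2.1 hrw j c h0
    have h2 : c + j ≤ 2 * n + 2 ^ (h - μ) * (2 ^ μ - 1) := by exact_mod_cast this
    omega

theorem coeff_mul_pow_char {K : Type*} [Field K] [CharP K 2] (P lam : PowerSeries K) (r m i0 : ℕ)
    (hi : i0 < 2 ^ r) :
    PowerSeries.coeff (2 ^ r * m + i0) (P * lam ^ 2 ^ r) =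
      ∑ m' ∈ Finset.range (m + 1), PowerSeries.coeff (2 ^ r * m + i0 - 2 ^ r * m') P *
        (PowerSeries.coeff m' lam) ^ 2 ^ r := by
  haveI : CharP (PowerSeries K) 2 := charP_of_injective_ringHom (f := (PowerSeries.C : K →+* PowerSeries K))
    PowerSeries.C_injective 2
  have h1 : lam = PowerSeries.X ^ (m + 1) * (PowerSeries.mk fun i ↦ PowerSeries.coeff (i + (m + 1)) lam) +
      ∑ m' ∈ Finset.range (m + 1), PowerSeries.C (PowerSeries.coeff m' lam) * PowerSeries.X ^ m' := by
    have := lam.eq_X_pow_mul_shift_add_trunc (m + 1)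
    conv_lhs => rw [this]
    congr 1
    ext c
    rw [Polynomial.coeff_coe, PowerSeries.coeff_trunc, map_sum]
    simp only [PowerSeries.coeff_C_mul_X_pow]
    simp
  set R := (PowerSeries.mk fun i ↦ PowerSeries.coeff (i + (m + 1)) lam)
  have h2 : lam ^ 2 ^ r = PowerSeries.X ^ (2 ^ r * (m + 1)) * R ^ 2 ^ r +
      ∑ m' ∈ Finset.range (m + 1), PowerSeries.C (PowerSeries.coeff m' lam ^ 2 ^ r) * PowerSeries.X ^ (2 ^ r * m') := by
    have h3 := congrArg (iterateFrobenius (PowerSeries K) 2 r) h1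
    rw [map_add, map_sum] at h3
    simp only [iterateFrobenius_def, mul_pow, ← pow_mul, ← map_pow] at h3
    rw [h3, mul_comm (m + 1)]
    congr 1
    exact Finset.sum_congr rfl fun m' _ => by rw [mul_comm m']
  rw [h2, mul_add, map_add, mul_left_comm, PowerSeries.coeff_X_pow_mul', if_neg, zero_add, Finset.mul_sum, map_sum]
  · refine Finset.sum_congr rfl fun m' hm' => ?_
    rw [← mul_assoc, mul_comm P, mul_assoc, PowerSeries.coeff_C_mul, PowerSeries.coeff_mul_X_pow', if_pos, mul_comm]
    have : m' ≤ m := by have := Finset.mem_range.1 hm'; omega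
    have := Nat.mul_le_mul_left (2 ^ r) this
    omega
  · rw [mul_add, mul_one]; omega

/-- polynomial with coefficients `c` on a finite set of exponents -/
noncomputable def tp {D : Type*} [CommRing D] (T : Finset (ℕ × ℕ)) (c : ℕ × ℕ → D) : D[X][X] :=
  ∑ p ∈ T, C (C (c p) * X ^ p.1) * X ^ p.2

theorem coeff_tp {D : Type*} [CommRing D] (T : Finset (ℕ × ℕ)) (c : ℕ × ℕ → D) (i l : ℕ) :
    ((tp T c).coeff l).coeff i = if (i, l) ∈ T then c (i, l) else 0 := by
  rw [tp, finset_sum_coeff, finset_sum_coeff]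
  have : ∀ p ∈ T, ((C (C (c p) * X ^ p.1) * X ^ p.2 : D[X][X]).coeff l).coeff i = if (i, l) = p then c p else 0 := by
    intro p _
    rw [coeff_C_mul_X_pow]
    rcases p with ⟨p1, p2⟩
    by_cases h2 : l = p2
    · rw [if_pos h2, coeff_C_mul_X_pow]
      simp [h2]
    · rw [if_neg h2, if_neg (by simp [h2]), coeff_zero]
  rw [Finset.sum_congr rfl this, Finset.sum_ite_eq]

theorem psEval_tp {D : Type*} [CommRing D] (ξ : PowerSeries D) (T : Finset (ℕ × ℕ)) (c : ℕ × ℕ → D) :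
    psEval ξ (tp T c) = ∑ p ∈ T, PowerSeries.C (c p) * (PowerSeries.X ^ p.1 * ξ ^ p.2) := by
  rw [tp, map_sum]
  refine Finset.sum_congr rfl fun p _ => ?_
  rw [map_mul, psEval_C, map_pow, psEval_X]
  simp [mul_assoc]

theorem natDegree_tp {D : Type*} [CommRing D] (T : Finset (ℕ × ℕ)) (c : ℕ × ℕ → D) (n : ℕ) (hn : 1 ≤ n)
    (hT : ∀ p ∈ T, p.2 < n) : (tp T c).natDegree < n := by
  have : (tp T c).natDegree ≤ n - 1 := by
    rw [natDegree_le_iff_coeff_eq_zero]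
    intro l hl
    ext i
    rw [coeff_tp, if_neg, coeff_zero]
    intro h; have := hT _ h; simp only at this; omega
  omega

theorem natDegree_coeff_tp {D : Type*} [CommRing D] (T : Finset (ℕ × ℕ)) (c : ℕ × ℕ → D) (a : ℕ)
    (hT : ∀ p ∈ T, p.1 ≤ a) (l : ℕ) : ((tp T c).coeff l).natDegree ≤ a := by
  rw [natDegree_le_iff_coeff_eq_zero]
  intro i hi
  rw [coeff_tp, if_neg]
  intro h; have := hT _ h; simp only at this; omega

theorem stB_ne {K : Type*} [Field K] [CharP K 2] [IsAlgClosed K] (r n a b : ℕ) (hn : 1 ≤ n)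
    (hr : n * a + n * n < 2 ^ r) (G : K[X][X]) (ξ : PowerSeries K) (hGn : G.natDegree = n)
    (hGd : ∀ c, (G.coeff c).natDegree ≤ n) (hξ : psEval ξ G = 0)
    (hres : ∀ u : K[X][X], u ≠ 0 → u.natDegree < n → resultant G u n u.natDegree ≠ 0)
    (e : (ℕ × ℕ) × (ℕ × ℕ) → K) (he : ∃ p ∈ Tset n a ×ˢ Tset n b, e p ≠ 0) :
    psEval ξ (stB (2 ^ r) (Tset n a ×ˢ Tset n b) e) ≠ 0 := by
  classical
  set lam : ℕ × ℕ → PowerSeries K := fun p => PowerSeries.X ^ p.1 * ξ ^ p.2 with hlam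
  set α : ℕ → K[X][X] := fun m => tp (Tset n a) fun p =>
    ∑ p' ∈ Tset n b, e (p, p') * (PowerSeries.coeff m (lam p')) ^ 2 ^ r with hα
  have hTa : ∀ a, ∀ p ∈ Tset n a, p.1 ≤ a := fun a p hp => by have := mem_Tset.1 hp; omega
  have hTn : ∀ a, ∀ p ∈ Tset n a, p.2 < n := fun a p hp => (mem_Tset.1 hp).1
  have hex : ∃ m, α m ≠ 0 := by
    obtain ⟨p0, hp0, hep⟩ := he
    rw [Finset.mem_product] at hp0
    set e'' : ℕ × ℕ → K := fun p' => (iterateFrobeniusEquiv K 2 r).symm (e (p0.1, p')) with he''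
    have hee : ∀ p, e'' p ^ 2 ^ r = e (p0.1, p) := by
      intro p
      rw [← iterateFrobeniusEquiv_def]
      exact RingEquiv.apply_symm_apply _ _
    set u := tp (Tset n b) e'' with hu
    have hu0 : u ≠ 0 := by
      intro h0
      have h1 := coeff_tp (Tset n b) e'' p0.2.1 p0.2.2
      rw [← hu, h0, if_pos hp0.2] at h1
      simp only [coeff_zero] at h1
      have h2 := hee p0.2
      rw [← h1] at h2
      apply hep
      rw [← h2]
      simp
    have hun : u.natDegree < n := natDegree_tp _ _ _ hn (hTn b)
    obtain ⟨m, -, hm⟩ := ord_bound G u ξ n b hn hGn hGd hun.le (natDegree_coeff_tp _ _ _ (hTa b)) hξ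
      (hres u hu0 hun)
    refine ⟨m, fun h0 => hm ?_⟩
    have h1 := coeff_tp (Tset n a) (fun p => ∑ p' ∈ Tset n b, e (p, p') * (PowerSeries.coeff m (lam p')) ^ 2 ^ r) p0.1.1 p0.1.2
    have h0' : tp (Tset n a) (fun p => ∑ p' ∈ Tset n b, e (p, p') * (PowerSeries.coeff m (lam p')) ^ 2 ^ r) = 0 := h0
    rw [h0', if_pos hp0.1] at h1
    simp only [coeff_zero] at h1
    rw [hu, psEval_tp, map_sum]
    simp only [PowerSeries.coeff_C_mul]
    have h2 : (∑ p ∈ Tset n b, e'' p * PowerSeries.coeff m (lam p)) ^ 2 ^ r = 0 := by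
      rw [← iterateFrobenius_def, map_sum, h1]
      refine Finset.sum_congr rfl fun p _ => ?_
      rw [iterateFrobenius_def, mul_pow, hee]
    exact pow_eq_zero_iff (by positivity) |>.1 h2
  set m := Nat.find hex with hm
  have hm1 : α m ≠ 0 := Nat.find_spec hex
  have hm2 : ∀ m' < m, α m' = 0 := fun m' h => by
    have := Nat.find_min hex h
    push Not at this; exact this
  have hαn : (α m).natDegree < n := natDegree_tp _ _ _ hn (hTn a)
  obtain ⟨i0, hi0, hi1⟩ := ord_bound G (α m) ξ n a hn hGn hGd hαn.le (natDegree_coeff_tp _ _ _ (hTa a)) hξ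
      (hres _ hm1 hαn)
  intro h0
  apply hi1
  have h1 : psEval ξ (stB (2 ^ r) (Tset n a ×ˢ Tset n b) e) =
      ∑ p ∈ Tset n a ×ˢ Tset n b, PowerSeries.C (e p) * (lam p.1 * lam p.2 ^ 2 ^ r) := by
    rw [stB, map_sum]
    refine Finset.sum_congr rfl fun p _ => ?_
    rw [map_mul, psEval_C, map_pow, psEval_X]
    simp only [hlam, Polynomial.coe_mul, Polynomial.coe_C, Polynomial.coe_pow, Polynomial.coe_X]
    ring
  have h2 := congrArg (PowerSeries.coeff (2 ^ r * m + i0)) h1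
  rw [h0, map_zero, map_sum] at h2
  simp only [PowerSeries.coeff_C_mul, coeff_mul_pow_char _ _ r m i0 (by omega), Finset.mul_sum] at h2
  rw [Finset.sum_comm] at h2
  have h3 : ∀ m', ∑ p ∈ Tset n a ×ˢ Tset n b, e p * ((PowerSeries.coeff (2 ^ r * m + i0 - 2 ^ r * m')) (lam p.1) *
      (PowerSeries.coeff m') (lam p.2) ^ 2 ^ r) = PowerSeries.coeff (2 ^ r * m + i0 - 2 ^ r * m') (psEval ξ (α m')) := by
    intro m'
    simp only [hα]
    rw [psEval_tp, map_sum, Finset.sum_product]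
    refine Finset.sum_congr rfl fun p _ => ?_
    rw [PowerSeries.coeff_C_mul, Finset.sum_mul]
    refine Finset.sum_congr rfl fun p' _ => ?_
    ring
  rw [Finset.sum_congr rfl fun m' _ => h3 m', Finset.sum_range_succ, Finset.sum_eq_zero, zero_add,
    Nat.add_sub_cancel_left] at h2
  · exact h2.symm
  · intro m' hm'
    rw [hm2 m' (Finset.mem_range.1 hm'), map_zero, map_zero]

theorem stB_map {F K : Type*} [CommRing F] [CommRing K] (φ : F →+* K) (Q : ℕ) (S : Finset ((ℕ × ℕ) × (ℕ × ℕ)))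
    (e : (ℕ × ℕ) × (ℕ × ℕ) → F) : (stB Q S e).map (mapRingHom φ) = stB Q S (fun p => φ (e p)) := by
  simp [stB, Polynomial.map_sum]

theorem curve_thm {F K : Type*} [Field F] [Fintype F] [CharP F 2] [Field K] [IsAlgClosed K] [Algebra F K]
    (h n : ℕ) (hq : Fintype.card F = 2 ^ h) (hn : 1 ≤ n) (hqn : 16 * (n + 2) ^ 4 < 2 ^ h)
    (G : F[X][X]) (hG : G.Monic) (hGn : G.natDegree = n) (hGw : G ∈ W2 F n) (ξ : PowerSeries K)
    (hξ : psEval ξ (G.map (mapRingHom (algebraMap F K))) = 0)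
    (hres : ∀ u : K[X][X], u ≠ 0 → u.natDegree < n →
      resultant (G.map (mapRingHom (algebraMap F K))) u n u.natDegree ≠ 0)
    (T : Finset F) (hTc : 2 ^ h ≤ T.card + (2 * n ^ 2 + 2 * n + 2))
    (hT : ∀ t ∈ T, (G.map (evalRingHom t)).Separable ∧ ∀ x, (G.map (evalRingHom t)).eval x ≠ 0) :
    False := by
  have : CharP K 2 := charP_of_injective_algebraMap (algebraMap F K).injective 2
  set μ := Nat.clog 2 (n ^ 2) with hμ
  have hM : n ^ 2 ≤ 2 ^ μ := Nat.le_pow_clog (by norm_num) _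
  have hM2 : 2 ^ μ ≤ 2 * n ^ 2 := by
    rcases Nat.lt_or_ge 1 n with h1 | h1
    · have h2 : 1 < n ^ 2 := by nlinarith
      have h3 := Nat.pow_pred_clog_lt_self (b := 2) (by norm_num) h2
      have h4 : 0 < μ := Nat.clog_pos (by norm_num) h2
      have h5 : 2 ^ μ = 2 * 2 ^ μ.pred := by
        rw [← pow_succ', Nat.pred_eq_sub_one, Nat.sub_add_cancel h4]
      rw [h5]; rw [← hμ] at h3; omega
    · have : n = 1 := by omega
      rw [hμ, this]; simp
  have hlt : 2 ^ μ < 2 ^ h := by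
    have h1 : n ^ 2 ≤ (n + 2) ^ 2 := Nat.pow_le_pow_left (by omega) 2
    have h2 : (n + 2) ^ 2 ≤ (n + 2) ^ 4 := Nat.pow_le_pow_right (by omega) (by norm_num)
    omega
  have hμh : μ ≤ h := ((Nat.pow_lt_pow_iff_right (by norm_num)).1 hlt).le
  have hQM : 2 ^ μ * 2 ^ (h - μ) = 2 ^ h := by rw [← pow_add]; congr 1; omega
  set Q := 2 ^ (h - μ) with hQ
  have hQb : 8 * (n + 2) ^ 2 < Q := by
    by_contra hcon
    push Not at hcon
    have h1 : 2 ^ h ≤ (2 * n ^ 2) * (8 * (n + 2) ^ 2) := by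
      rw [← hQM]; exact Nat.mul_le_mul hM2 hcon
    have h2 : (2 * n ^ 2) * (8 * (n + 2) ^ 2) ≤ 16 * (n + 2) ^ 4 := by
      have : n ^ 2 ≤ (n + 2) ^ 2 := Nat.pow_le_pow_left (by omega) 2
      calc (2 * n ^ 2) * (8 * (n + 2) ^ 2) ≤ (2 * (n + 2) ^ 2) * (8 * (n + 2) ^ 2) := by gcongr
        _ = _ := by ring
    omega
  have hQe : Q * (2 ^ μ - 1) + Q = 2 ^ h := by
    have : 1 ≤ 2 ^ μ := Nat.one_le_two_pow
    rw [← hQM, Nat.mul_sub, mul_one, mul_comm]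
    have := Nat.mul_le_mul_right Q this
    omega
  obtain ⟨e, ⟨p, hp, hep⟩, c, hc⟩ := stepanov_vanish (K := K) h μ n hq hμh hn hM G hG hGn hGw T hT (by
    rw [← hQ]; nlinarith)
  have hc' := congrArg (Polynomial.map (mapRingHom (algebraMap F K))) hc
  rw [stB_map, Polynomial.map_mul] at hc'
  have h1 := congrArg (psEval ξ) hc'
  rw [map_mul, hξ, zero_mul] at h1
  refine stB_ne (h - μ) n (2 * n) (2 ^ μ - 1) hn (by rw [← hQ]; nlinarith) (G.map (mapRingHom (algebraMap F K))) ξ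
    (by rw [hG.natDegree_map, hGn]) ?_ hξ hres _ ⟨p, hp, ?_⟩ h1
  · intro c
    rw [coeff_map, natDegree_le_iff_coeff_eq_zero]
    intro d hd
    rw [coe_mapRingHom, coeff_map]
    by_contra h0
    have := mem_W2.1 hGw c d (fun h => h0 (by rw [h, map_zero]))
    omega
  · exact fun h0 => hep ((map_eq_zero _).1 h0)

theorem exists_minor {L ι κ : Type*} [Field L] [Fintype ι] [Fintype κ] [DecidableEq κ] (A : Matrix ι κ L)
    (h : ∀ c : κ → L, A.mulVec c = 0 → c = 0) : ∃ f : κ → ι, (A.submatrix f id).det ≠ 0 := by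
  classical
  have hr : A.rank = Fintype.card κ := by
    rw [Matrix.rank, LinearMap.finrank_range_of_inj, Module.finrank_fintype_fun_eq_card]
    rw [← LinearMap.ker_eq_bot, LinearMap.ker_eq_bot']
    exact h
  rw [Matrix.rank_eq_finrank_span_row] at hr
  obtain ⟨f, hf, -, hli⟩ := Submodule.exists_fun_fin_finrank_span_eq L (Set.range A.row)
  choose g hg using hf
  let eq : κ ≃ Fin (Module.finrank L (Submodule.span L (Set.range A.row))) :=
    Fintype.equivFinOfCardEq hr.symm
  refine ⟨fun k => g (eq k), ?_⟩
  have hli2 : LinearIndependent L (A.submatrix (fun k => g (eq k)) id).row := by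
    have e : (A.submatrix (fun k => g (eq k)) id).row = f ∘ eq := by
      ext k j
      simp only [Function.comp_apply, ← hg]
      rfl
    rw [e]
    exact hli.comp eq eq.injective
  rw [Matrix.linearIndependent_rows_iff_isUnit, Matrix.isUnit_iff_isUnit_det] at hli2
  exact hli2.ne_zero

theorem coeff_coeff_swap {R : Type*} [CommRing R] (p : R[X][X]) (i j : ℕ) :
    ((Polynomial.Bivariate.swap p).coeff i).coeff j = (p.coeff j).coeff i := by
  induction p using Polynomial.induction_on' with
  | add p q hp hq => simp [hp, hq]
  | monomial n a =>
    induction a using Polynomial.induction_on' with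
    | add p q hp hq => simp only [map_add, coeff_add, hp, hq]
    | monomial m r =>
      rw [Polynomial.Bivariate.swap_monomial_monomial]
      simp only [coeff_monomial]
      split_ifs <;> simp_all [coeff_monomial]

theorem natDegree_swap_le {R : Type*} [CommRing R] (p : R[X][X]) (W : ℕ) :
    (Polynomial.Bivariate.swap p).natDegree ≤ W ↔ ∀ c, (p.coeff c).natDegree ≤ W := by
  simp only [natDegree_le_iff_coeff_eq_zero]
  constructor
  · intro h c i hi
    rw [← coeff_coeff_swap, h i hi, coeff_zero]
  · intro h i hi
    ext j
    rw [coeff_coeff_swap, h j i hi, coeff_zero]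

theorem tdeg_factor {R : Type*} [CommRing R] [IsDomain R] (p q : R[X][X]) (W : ℕ) (hp : p ≠ 0) (hq : q ≠ 0)
    (h : ∀ c, ((p * q).coeff c).natDegree ≤ W) : ∀ c, (p.coeff c).natDegree ≤ W := by
  rw [← natDegree_swap_le] at h ⊢
  rw [map_mul, natDegree_mul] at h
  · omega
  · simpa using hp
  · simpa using hq

theorem psEval_map {D E : Type*} [CommRing D] [CommRing E] (φ : D →+* E) (ξ : PowerSeries D) (p : D[X][X]) :
    psEval (PowerSeries.map φ ξ) (p.map (mapRingHom φ)) = PowerSeries.map φ (psEval ξ p) := by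
  have : (psEval (PowerSeries.map φ ξ)).comp (mapRingHom (mapRingHom φ)) = (PowerSeries.map φ).comp (psEval ξ) := by
    ext <;> simp [psEval]
  exact congrArg (fun f => f p) this

/-- series whose `m`-th coefficient has degree at most `m` -/
def degSub (K : Type*) [Field K] : Subring (PowerSeries K[X]) where
  carrier := {f | ∀ m, (PowerSeries.coeff m f).natDegree ≤ m}
  zero_mem' := fun m => by simp
  one_mem' := fun m => by rw [PowerSeries.coeff_one]; split_ifs <;> simp
  add_mem' := fun ha hb m => by
    rw [map_add]; exact (natDegree_add_le _ _).trans (max_le (ha m) (hb m))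
  neg_mem' := fun ha m => by rw [map_neg, natDegree_neg]; exact ha m
  mul_mem' := fun ha hb m => by
    rw [PowerSeries.coeff_mul]
    refine natDegree_sum_le_of_forall_le _ _ fun x hx => ?_
    have hx := Finset.HasAntidiagonal.mem_antidiagonal.1 hx
    refine natDegree_mul_le.trans ?_
    have h1 := ha x.1
    have h2 := hb x.2
    omega

theorem mem_degSub {K : Type*} [Field K] (f : PowerSeries K[X]) :
    f ∈ degSub K ↔ ∀ m, (PowerSeries.coeff m f).natDegree ≤ m := Iff.rfl

theorem hensel_root {K : Type*} [Field K] (G : K[X][X][X]) (γ : K[X]) (hG : G.Monic)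
    (hGs : ∀ c m, ((G.coeff c).coeff m).natDegree ≤ m)
    (hG0 : G.map (constantCoeff : K[X][X] →+* K[X]) = γ.map C) (ζ : K) (hζ : γ.eval ζ = 0)
    (hζ' : γ.derivative.eval ζ ≠ 0) :
    ∃ ξ : PowerSeries K[X], psEval ξ G = 0 ∧ ξ ∈ degSub K := by
  set f : (PowerSeries K[X])[X] := G.map coeToPowerSeries.ringHom with hf
  have hcc : (PowerSeries.constantCoeff).comp (coeToPowerSeries.ringHom (R := K[X])) = constantCoeff := by
    ext <;> simp
  have hfm : f.map (PowerSeries.constantCoeff) = γ.map C := by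
    rw [hf, Polynomial.map_map, hcc, hG0]
  have heval : ∀ (p : (PowerSeries K[X])[X]) a, PowerSeries.constantCoeff (p.eval a) =
      (p.map (PowerSeries.constantCoeff)).eval (PowerSeries.constantCoeff a) := by
    intro p a; rw [eval_map, eval₂_hom]
  have hunit : ∀ a : PowerSeries K[X], PowerSeries.constantCoeff a = C ζ →
      PowerSeries.constantCoeff (f.derivative.eval a) = C (γ.derivative.eval ζ) := by
    intro a ha
    rw [heval, ← derivative_map, hfm, derivative_map, ha, eval_map, eval₂_hom]
  obtain ⟨ξ, hξ, hξ0⟩ := HenselianRing.is_henselian (I := Ideal.span {(PowerSeries.X : PowerSeries K[X])})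
    f (hG.map _) (PowerSeries.C (C ζ)) (by
      rw [Ideal.mem_span_singleton, PowerSeries.X_dvd_iff, heval, hfm, PowerSeries.constantCoeff_C, eval_map, eval₂_hom, hζ, C_0])
    (by
      apply IsUnit.map
      rw [PowerSeries.isUnit_iff_constantCoeff, hunit _ (PowerSeries.constantCoeff_C _)]
      exact isUnit_C.2 (isUnit_iff_ne_zero.2 hζ'))
  refine ⟨ξ, ?_, ?_⟩
  · rw [IsRoot.def, hf, eval_map] at hξ
    exact hξ
  have h0 : PowerSeries.constantCoeff ξ = C ζ := by
    rw [Ideal.mem_span_singleton, PowerSeries.X_dvd_iff, map_sub, PowerSeries.constantCoeff_C, sub_eq_zero] at hξ0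
    exact hξ0
  have hfsub : ∀ a ∈ degSub K, f.eval a ∈ degSub K := by
    intro a ha
    rw [eval_eq_sum_range]
    refine Subring.sum_mem _ fun c _ => Subring.mul_mem _ ?_ (Subring.pow_mem _ ha _)
    intro m
    rw [hf, coeff_map, coeToPowerSeries.ringHom_apply, Polynomial.coeff_coe]
    exact hGs c m
  intro m
  induction m using Nat.strong_induction_on with
  | _ m ih =>
  rcases Nat.eq_zero_or_pos m with rfl | hm
  · rw [PowerSeries.coeff_zero_eq_constantCoeff_apply, h0, natDegree_C]
  set ξ' : PowerSeries K[X] := ((PowerSeries.trunc m ξ : K[X][X]) : PowerSeries K[X]) with hξ'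
  have hsub : ξ' ∈ degSub K := by
    intro i
    rw [hξ', Polynomial.coeff_coe, PowerSeries.coeff_trunc]
    split_ifs with hi
    · exact ih i hi
    · simp
  have hsplit := ξ.eq_X_pow_mul_shift_add_trunc m
  rw [← hξ'] at hsplit
  set η : PowerSeries K[X] := PowerSeries.mk fun i ↦ PowerSeries.coeff (i + m) ξ with hη
  obtain ⟨k, hk⟩ := binomExpansion f ξ' (PowerSeries.X ^ m * η)
  rw [add_comm ξ', ← hsplit, show f.eval ξ = 0 from hξ] at hk
  have hk2 := congrArg (PowerSeries.coeff m) hk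
  have e1 : f.derivative.eval ξ' * (PowerSeries.X ^ m * η) = PowerSeries.X ^ m * (f.derivative.eval ξ' * η) := by ring
  have e2 : k * (PowerSeries.X ^ m * η) ^ 2 = PowerSeries.X ^ (2 * m) * (k * η ^ 2) := by ring
  have hc' : PowerSeries.constantCoeff ξ' = C ζ := by
    rw [← PowerSeries.coeff_zero_eq_constantCoeff_apply, hξ', Polynomial.coeff_coe, PowerSeries.coeff_trunc, if_pos hm,
      PowerSeries.coeff_zero_eq_constantCoeff_apply, h0]
  rw [e1, e2, map_zero, map_add, map_add, PowerSeries.coeff_X_pow_mul', PowerSeries.coeff_X_pow_mul', if_pos le_rfl,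
    if_neg (by omega), add_zero, Nat.sub_self, PowerSeries.coeff_zero_eq_constantCoeff_apply, map_mul, hunit _ hc'] at hk2
  have e3 : PowerSeries.constantCoeff η = PowerSeries.coeff m ξ := by
    rw [← PowerSeries.coeff_zero_eq_constantCoeff_apply, hη, PowerSeries.coeff_mk, zero_add]
  rw [e3] at hk2
  have h5 := hfsub ξ' hsub m
  have h6 : C (γ.derivative.eval ζ) * PowerSeries.coeff m ξ = - PowerSeries.coeff m (f.eval ξ') := by
    linear_combination -hk2
  rw [← natDegree_C_mul hζ', h6, natDegree_neg]
  exact h5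

theorem bert_minor {K : Type*} [Field K] (n : ℕ) (hn : 1 ≤ n) (T : Finset (ℕ × ℕ))
    (hT : T = Finset.range (n+1) ×ˢ Finset.range n) (G : K[X][X][X])
    (hGn : G.natDegree = n) (hGd : ∀ c, (G.coeff c).natDegree ≤ n) (ξ : PowerSeries K[X]) (hξ : psEval ξ G = 0)
    (hres : ∀ u : K[X][X][X], u ≠ 0 → u.natDegree < n → resultant G u n u.natDegree ≠ 0) :
    ∃ g : T → Fin (2 * n ^ 2 + 1),
      (Matrix.of fun p q : T =>
        PowerSeries.coeff (g p : ℕ) (PowerSeries.X ^ q.1.1 * ξ ^ q.1.2)).det ≠ 0 := by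
  classical
  have hT1 : ∀ p ∈ T, p.1 ≤ n := by
    intro p hp; rw [hT, Finset.mem_product, Finset.mem_range, Finset.mem_range] at hp; omega
  have hT2 : ∀ p ∈ T, p.2 < n := by
    intro p hp; rw [hT, Finset.mem_product, Finset.mem_range, Finset.mem_range] at hp; omega
  let M : Matrix (Fin (2 * n ^ 2 + 1)) T K[X] := Matrix.of fun i q =>
    PowerSeries.coeff (i : ℕ) (PowerSeries.X ^ q.1.1 * ξ ^ q.1.2)
  have key : ∀ c : T → K[X], M.mulVec c = 0 → c = 0 := by
    intro c hc
    by_contra hne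
    let c' : ℕ × ℕ → K[X] := fun p => if h : p ∈ T then c ⟨p, h⟩ else 0
    have hu0 : tp T c' ≠ 0 := by
      intro h0
      apply hne
      ext1 p
      have := coeff_tp T c' p.1.1 p.1.2
      rw [h0, if_pos p.2] at this
      simpa [c'] using this.symm
    obtain ⟨i, hi, hi1⟩ := ord_bound G (tp T c') ξ n n hn hGn hGd (natDegree_tp T c' n hn hT2).le
      (natDegree_coeff_tp T c' n hT1) hξ (hres _ hu0 (natDegree_tp T c' n hn hT2))
    apply hi1
    have := congrFun hc ⟨i, by have : 2 * n ^ 2 = n * n + n * n := by ring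
                               omega⟩
    rw [psEval_tp, map_sum]
    simp only [PowerSeries.coeff_C_mul]
    rw [← Finset.sum_attach]
    rw [Matrix.mulVec, dotProduct] at this
    rw [Pi.zero_apply] at this
    rw [← this, Finset.univ_eq_attach]
    refine Finset.sum_congr rfl fun p _ => ?_
    simp [c', M, mul_comm]
  obtain ⟨f, hf⟩ := exists_minor (M.map (algebraMap K[X] (FractionRing K[X]))) (by
    intro c hc
    obtain ⟨b, hb⟩ := IsLocalization.exist_integer_multiples_of_finite (nonZeroDivisors K[X]) c
    choose c' hc' using hb
    have h1 : M.mulVec c' = 0 := by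
      apply _root_.funext; intro i
      apply IsFractionRing.injective K[X] (FractionRing K[X])
      have := congrFun hc i
      simp only [Matrix.mulVec, dotProduct, Matrix.map_apply, Pi.zero_apply, map_sum, map_mul, hc', map_zero, Algebra.smul_def] at this ⊢
      have h2 : ∀ x, (algebraMap K[X] (FractionRing K[X])) (M i x) * (algebraMap K[X] (FractionRing K[X]) b * c x) =
        algebraMap K[X] (FractionRing K[X]) b * ((algebraMap K[X] (FractionRing K[X])) (M i x) * c x) := by intro x; ring
      rw [Finset.sum_congr rfl fun x _ => h2 x, ← Finset.mul_sum, this, mul_zero]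
    have h2 := key c' h1
    ext p
    have h3 := hc' p
    rw [h2, Pi.zero_apply, map_zero, eq_comm, Algebra.smul_def] at h3
    rcases mul_eq_zero.1 h3 with h4 | h4
    · exact absurd ((IsFractionRing.injective K[X] (FractionRing K[X])) (h4.trans (map_zero _).symm)) (nonZeroDivisors.ne_zero b.2)
    · simpa using h4)
  refine ⟨f, fun h0 => hf ?_⟩
  have : (M.map (algebraMap K[X] (FractionRing K[X]))).submatrix f id =
    (algebraMap K[X] (FractionRing K[X])).mapMatrix (Matrix.of fun p q : T =>
        PowerSeries.coeff (f p : ℕ) (PowerSeries.X ^ q.1.1 * ξ ^ q.1.2)) := by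
    ext p q; simp [M]
  rw [this, ← RingHom.map_det, h0, map_zero]

theorem bert_s0 {K F : Type*} [Field K] [Field F] [Fintype F] (φ : F →+* K) (n : ℕ) (hn : 1 ≤ n) (hq : 2 * n ^ 4 + 2 * n ^ 3 < Fintype.card F) (G : K[X][X][X])
    (hGn : G.natDegree = n) (hGd : ∀ c, (G.coeff c).natDegree ≤ n) (ξ : PowerSeries K[X]) (hξ : psEval ξ G = 0)
    (hξd : ξ ∈ degSub K)
    (hres : ∀ u : K[X][X][X], u ≠ 0 → u.natDegree < n → resultant G u n u.natDegree ≠ 0) :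
    ∃ s0 : F, ∀ u : K[X][X], u.natDegree < n → (∀ c, (u.coeff c).natDegree ≤ n) →
      psEval (PowerSeries.map (evalRingHom (φ s0)) ξ) u = 0 → u = 0 := by
  classical
  obtain ⟨g, hg⟩ := bert_minor n hn _ rfl G hGn hGd ξ hξ hres
  generalize hT : Finset.range (n+1) ×ˢ Finset.range n = T at g hg
  replace hT := hT.symm
  set Δ := (Matrix.of fun p q : T => PowerSeries.coeff (g p : ℕ) (PowerSeries.X ^ q.1.1 * ξ ^ q.1.2)) with hΔ
  have hXd : (PowerSeries.X : PowerSeries K[X]) ∈ degSub K := by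
    intro m; rw [PowerSeries.coeff_X]; split_ifs <;> simp
  have hdeg : Δ.det.natDegree < Fintype.card F := by
    rw [← Matrix.det_transpose]
    refine (natDegree_det_le _ (fun _ => 2 * n ^ 2) ?_).trans_lt ?_
    · intro i j
      have : (PowerSeries.X ^ i.1.1 * ξ ^ i.1.2) ∈ degSub K :=
        Subring.mul_mem _ (Subring.pow_mem _ hXd _) (Subring.pow_mem _ hξd _)
      refine (this (g j)).trans ?_
      have := (g j).2
      omega
    · rw [Finset.sum_const, Finset.card_univ, Fintype.card_coe, hT, Finset.card_product, Finset.card_range, Finset.card_range, smul_eq_mul]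
      refine lt_of_eq_of_lt ?_ hq
      ring
  have : ∃ s0 : F, Δ.det.eval (φ s0) ≠ 0 := by
    by_contra! h
    exact hg (eq_zero_of_natDegree_lt_card_of_eval_eq_zero _ φ.injective h hdeg)
  obtain ⟨s0, hs0⟩ := this
  refine ⟨s0, fun u hun hud hu => ?_⟩
  set c : ℕ × ℕ → K := fun p => (u.coeff p.2).coeff p.1 with hc
  have hut : u = tp T c := by
    ext l i
    rw [coeff_tp]
    split_ifs with h
    · rfl
    · rw [hT, Finset.mem_product, Finset.mem_range, Finset.mem_range] at h
      by_cases h1 : l < n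
      · have : n < i := by simp only at h; omega
        exact coeff_eq_zero_of_natDegree_lt ((hud l).trans_lt this)
      · rw [coeff_eq_zero_of_natDegree_lt (p := u) (by omega), coeff_zero]
  have hdet : ((evalRingHom (φ s0)).mapMatrix Δ).det ≠ 0 := by
    rw [← RingHom.map_det]; exact hs0
  have hmv : ((evalRingHom (φ s0)).mapMatrix Δ).mulVec (fun q : T => c q) = 0 := by
    ext p
    rw [hut, psEval_tp] at hu
    have := congrArg (PowerSeries.coeff (g p : ℕ)) hu
    rw [map_sum, map_zero, ← Finset.sum_attach] at this
    rw [Pi.zero_apply, ← this, Matrix.mulVec, dotProduct, Finset.univ_eq_attach]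
    refine Finset.sum_congr rfl fun q _ => ?_
    rw [PowerSeries.coeff_C_mul, mul_comm]
    congr 1
    have e : (PowerSeries.X : PowerSeries K) ^ q.1.1 * (PowerSeries.map (evalRingHom (φ s0))) ξ ^ q.1.2 =
      PowerSeries.map (evalRingHom (φ s0)) (PowerSeries.X ^ q.1.1 * ξ ^ q.1.2) := by simp
    rw [e, PowerSeries.coeff_map]
    rfl
  have h0 := Matrix.eq_zero_of_mulVec_eq_zero hdet hmv
  rw [hut]
  ext l i
  rw [coeff_tp]
  split_ifs with h
  · simpa using congrFun h0 ⟨_, h⟩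
  · simp

theorem bertini {K F : Type*} [Field K] [Field F] [Fintype F] (φ : F →+* K) (n : ℕ) (hn : 1 ≤ n)
    (hq : 2 * n ^ 4 + 2 * n ^ 3 < Fintype.card F) (G : K[X][X][X]) (hG : G.Monic)
    (hGn : G.natDegree = n) (hGd : ∀ c, (G.coeff c).natDegree ≤ n)
    (hGs : ∀ c m, ((G.coeff c).coeff m).natDegree ≤ m) (γ : K[X])
    (hG0 : G.map (constantCoeff : K[X][X] →+* K[X]) = γ.map C) (ζ : K) (hζ : γ.eval ζ = 0)
    (hζ' : γ.derivative.eval ζ ≠ 0)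
    (hres : ∀ u : K[X][X][X], u ≠ 0 → u.natDegree < n → resultant G u n u.natDegree ≠ 0) :
    ∃ s0 : F, ∃ ξ0 : PowerSeries K, psEval ξ0 (G.map (mapRingHom (evalRingHom (φ s0)))) = 0 ∧
      ∀ u : K[X][X], u ≠ 0 → u.natDegree < n →
        resultant (G.map (mapRingHom (evalRingHom (φ s0)))) u n u.natDegree ≠ 0 := by
  obtain ⟨ξ, hξ, hξd⟩ := hensel_root G γ hG hGs hG0 ζ hζ hζ'
  obtain ⟨s0, hs0⟩ := bert_s0 φ n hn hq G hGn hGd ξ hξ hξd hres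
  have hroot : psEval (PowerSeries.map (evalRingHom (φ s0)) ξ) (G.map (mapRingHom (evalRingHom (φ s0)))) = 0 := by
    rw [psEval_map, hξ, map_zero]
  refine ⟨s0, PowerSeries.map (evalRingHom (φ s0)) ξ, hroot, ?_⟩
  set G0 := G.map (mapRingHom (evalRingHom (φ s0))) with hG0d
  set ξ0 := PowerSeries.map (evalRingHom (φ s0)) ξ
  have hG0m : G0.Monic := hG.map _
  have hG0n : G0.natDegree = n := by rw [hG0d, hG.natDegree_map, hGn]
  have hG0t : ∀ c, (G0.coeff c).natDegree ≤ n := by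
    intro c
    rw [hG0d, coeff_map, coe_mapRingHom]
    exact natDegree_map_le.trans (hGd c)
  have hirr : Irreducible G0 := by
    rw [hG0m.irreducible_iff_natDegree]
    refine ⟨fun h => ?_, fun p q hp hq hpq => ?_⟩
    · rw [h, natDegree_one] at hG0n; omega
    · by_contra! hcon
      have hadd : p.natDegree + q.natDegree = n := by rw [← hp.natDegree_mul hq, hpq, hG0n]
      rw [← hpq, map_mul] at hroot
      rcases mul_eq_zero.1 hroot with h0 | h0
      · exact hp.ne_zero (hs0 p (by omega) (tdeg_factor p q n hp.ne_zero hq.ne_zero (by rw [hpq]; exact hG0t)) h0)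
      · exact hq.ne_zero (hs0 q (by omega) (tdeg_factor q p n hq.ne_zero hp.ne_zero (by rw [mul_comm, hpq]; exact hG0t)) h0)
  intro u hu hun
  exact resultant_ne_zero_of_irred (algebraMap K[X] (FractionRing K[X])) (IsFractionRing.injective _ _) G0 u n hG0n
    ((hG0m.irreducible_iff_irreducible_map_fraction_map (K := FractionRing K[X])).1 hirr) hu hun

/-- `g(xλ, s, λ)` as a polynomial in `λ` over `R[x]` -/
noncomputable def psi {R : Type*} [CommRing R] (s : R) : MvPolynomial (Fin 3) R →+* R[X][X] :=
  MvPolynomial.eval₂Hom (C.comp C) ![C X * X, C (C s), X]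

/-- `t^n g(x/t, s, 1/t)` as a polynomial in `x` over `R[t]` -/
noncomputable def gs {R : Type*} [CommRing R] (n : ℕ) (s : R) (g : MvPolynomial (Fin 3) R) : R[X][X] :=
  Polynomial.Bivariate.swap (reflect n (psi s g))

theorem coeff_psi {R : Type*} [CommRing R] (s : R) (g : MvPolynomial (Fin 3) R) (k c : ℕ) :
    ((psi s g).coeff k).coeff c =
      ∑ m ∈ g.support, if m 0 + m 2 = k ∧ m 0 = c then g.coeff m * s ^ (m 1) else 0 := by
  rw [psi, MvPolynomial.coe_eval₂Hom, MvPolynomial.eval₂_eq', finsetSum_coeff, finsetSum_coeff]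
  refine Finset.sum_congr rfl fun m _ => ?_
  rw [Fin.prod_univ_three]
  have : (C.comp C) (MvPolynomial.coeff m g) * ((![C X * X, C (C s), X] : Fin 3 → R[X][X]) 0 ^ m 0 *
      (![C X * X, C (C s), X] : Fin 3 → R[X][X]) 1 ^ m 1 * (![C X * X, C (C s), X] : Fin 3 → R[X][X]) 2 ^ m 2) =
      monomial (m 0 + m 2) (monomial (m 0) (MvPolynomial.coeff m g * s ^ m 1)) := by
    simp only [← C_mul_X_pow_eq_monomial]
    simp
    ring
  rw [this, coeff_monomial]
  split_ifs with h1 h2 h2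
  · rw [coeff_monomial, if_pos h2.2]
  · rw [coeff_monomial, if_neg (by tauto)]
  · tauto
  · simp

theorem supp_le {R : Type*} [CommRing R] {g : MvPolynomial (Fin 3) R} {m : Fin 3 →₀ ℕ} (hm : m ∈ g.support) :
    m 0 + m 1 + m 2 ≤ g.totalDegree := by
  have := MvPolynomial.le_totalDegree hm
  rw [Finsupp.sum_fintype _ _ (by simp), Fin.sum_univ_three] at this
  exact this

theorem natDegree_psi {R : Type*} [CommRing R] (s : R) (g : MvPolynomial (Fin 3) R) :
    (psi s g).natDegree ≤ g.totalDegree := by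
  rw [natDegree_le_iff_coeff_eq_zero]
  intro k hk
  ext c
  rw [coeff_psi, coeff_zero]
  refine Finset.sum_eq_zero fun m hm => if_neg ?_
  have := supp_le hm
  omega

theorem natDegree_coeff_psi {R : Type*} [CommRing R] (s : R) (g : MvPolynomial (Fin 3) R) (k : ℕ) :
    ((psi s g).coeff k).natDegree ≤ k := by
  rw [natDegree_le_iff_coeff_eq_zero]
  intro c hc
  rw [coeff_psi]
  refine Finset.sum_eq_zero fun m hm => if_neg ?_
  omega

theorem coeff_psi_top {R : Type*} [CommRing R] (s s' : R) (g : MvPolynomial (Fin 3) R) :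
    (psi s g).coeff g.totalDegree = (psi s' g).coeff g.totalDegree := by
  ext c
  rw [coeff_psi, coeff_psi]
  refine Finset.sum_congr rfl fun m hm => ?_
  split_ifs with h
  · have := supp_le hm
    rw [show m 1 = 0 by omega, pow_zero, pow_zero]
  · rfl

theorem psi_map {R S : Type*} [CommRing R] [CommRing S] (φ : R →+* S) (s : R) (g : MvPolynomial (Fin 3) R) :
    psi (φ s) (MvPolynomial.map φ g) = (psi s g).map (mapRingHom φ) := by
  have : (psi (φ s)).comp (MvPolynomial.map φ) = (mapRingHom (mapRingHom φ)).comp (psi s) := by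
    apply MvPolynomial.ringHom_ext
    · intro r; simp [psi]
    · intro i; fin_cases i <;> simp [psi]
  exact congrArg (fun f => f g) this

theorem coeff_gs {R : Type*} [CommRing R] (n : ℕ) (s : R) (g : MvPolynomial (Fin 3) R) (c m : ℕ) :
    ((gs n s g).coeff c).coeff m = ((psi s g).coeff (revAt n m)).coeff c := by
  rw [gs, coeff_coeff_swap, coeff_reflect]

theorem gs_map {R S : Type*} [CommRing R] [CommRing S] (φ : R →+* S) (n : ℕ) (s : R) (g : MvPolynomial (Fin 3) R) :
    gs n (φ s) (MvPolynomial.map φ g) = (gs n s g).map (mapRingHom φ) := by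
  ext c m
  rw [coeff_gs, psi_map, coeff_map, coeff_map, coe_mapRingHom, coeff_map, coeff_map, coeff_gs]

theorem gs_eval {R S : Type*} [CommRing R] [CommRing S] (φ : R →+* S) (s : R)
    (g : MvPolynomial (Fin 3) R) (τ z y : S) (h : τ * z = 1) :
    eval₂ (eval₂RingHom φ τ) (τ * y) (gs g.totalDegree s g) =
      τ ^ g.totalDegree * MvPolynomial.eval₂ φ ![y, φ s, z] g := by
  set n := g.totalDegree with hn
  have hsw : ∀ Q : R[X][X], eval₂ (eval₂RingHom φ τ) (τ * y) (Polynomial.Bivariate.swap Q) =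
      eval₂ (eval₂RingHom φ (τ * y)) τ Q := by
    intro Q
    induction Q using Polynomial.induction_on' with
    | add p q hp hq => simp [hp, hq, eval₂_add]
    | monomial n a =>
      induction a using Polynomial.induction_on' with
      | add p q hp hq => simp only [map_add, eval₂_add, hp, hq]
      | monomial m r =>
        rw [Polynomial.Bivariate.swap_monomial_monomial]
        simp only [eval₂_monomial, coe_eval₂RingHom]
        ring
  have hps : eval₂ (eval₂RingHom φ (τ * y)) z (psi s g) = MvPolynomial.eval₂ φ ![y, φ s, z] g := by
    have : (eval₂RingHom (eval₂RingHom φ (τ * y)) z).comp (psi s) = MvPolynomial.eval₂Hom φ ![y, φ s, z] := by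
      apply MvPolynomial.ringHom_ext
      · intro r; simp [psi]
      · intro i; fin_cases i
        · simp [psi]; linear_combination y * h
        · simp [psi]
        · simp [psi]
    exact congrArg (fun f => f g) this
  let _ : Invertible z := ⟨τ, h, by rw [mul_comm]; exact h⟩
  have key := eval₂_reflect_mul_pow (eval₂RingHom φ (τ * y)) z n (psi s g) (natDegree_psi s g)
  rw [gs, hsw, ← hps, ← key]
  have : (⅟z : S) = τ := rfl
  rw [this]
  have h2 : τ ^ n * z ^ n = 1 := by rw [← mul_pow, h, one_pow]
  linear_combination (- eval₂ (eval₂RingHom φ (τ * y)) τ (reflect n (psi s g))) * h2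

section
variable {R : Type*} [CommRing R] (s : R) (g : MvPolynomial (Fin 3) R)

theorem gs_W2 : gs g.totalDegree s g ∈ W2 R g.totalDegree := by
  rw [mem_W2]
  intro c m h
  rw [coeff_gs] at h
  by_cases hm : m ≤ g.totalDegree
  · rw [revAt_le hm] at h
    have h1 := le_natDegree_of_ne_zero h
    have h2 := natDegree_coeff_psi s g (g.totalDegree - m)
    omega
  · rw [revAt_eq_self_of_lt (by omega)] at h
    exact absurd (by rw [coeff_eq_zero_of_natDegree_lt ((natDegree_psi s g).trans_lt (by omega)), coeff_zero]) h

theorem gs_natDegree_le : (gs g.totalDegree s g).natDegree ≤ g.totalDegree := by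
  rw [natDegree_le_iff_coeff_eq_zero]
  intro c hc
  ext m
  by_contra h
  have := mem_W2.1 (gs_W2 s g) c m h
  omega

theorem gs_coeff_natDegree (c : ℕ) : ((gs g.totalDegree s g).coeff c).natDegree ≤ g.totalDegree := by
  rw [natDegree_le_iff_coeff_eq_zero]
  intro m hm
  by_contra h
  have := mem_W2.1 (gs_W2 s g) c m h
  omega

theorem gs_constantCoeff :
    (gs g.totalDegree s g).map (constantCoeff : R[X] →+* R) = (psi s g).coeff g.totalDegree := by
  ext c
  rw [coeff_map, constantCoeff_apply, coeff_gs, revAt_le (Nat.zero_le _), Nat.sub_zero]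

theorem gs_coeff_top :
    (gs g.totalDegree s g).coeff g.totalDegree = C (((psi s g).coeff g.totalDegree).coeff g.totalDegree) := by
  ext m
  rcases Nat.eq_zero_or_pos m with rfl | hm
  · rw [coeff_gs, revAt_le (Nat.zero_le _), Nat.sub_zero, coeff_C_zero]
  · rw [coeff_C_of_ne_zero hm.ne']
    by_contra h
    have := mem_W2.1 (gs_W2 s g) _ m h
    omega

theorem gs_monic (h : ((psi s g).coeff g.totalDegree).coeff g.totalDegree = 1) :
    (gs g.totalDegree s g).Monic :=
  monic_of_natDegree_le_of_coeff_eq_one _ (gs_natDegree_le s g) (by rw [gs_coeff_top, h, C_1])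

theorem gs_natDegree [Nontrivial R] (h : ((psi s g).coeff g.totalDegree).coeff g.totalDegree = 1) :
    (gs g.totalDegree s g).natDegree = g.totalDegree :=
  natDegree_eq_of_le_of_coeff_ne_zero (gs_natDegree_le s g) (by rw [gs_coeff_top, h, C_1]; exact one_ne_zero)

end

theorem tdeg_map_le {R S : Type*} [CommRing R] [CommRing S] (φ : R →+* S) (g : MvPolynomial (Fin 3) R) :
    (MvPolynomial.map φ g).totalDegree ≤ g.totalDegree :=
  Finset.sup_mono (MvPolynomial.support_map_subset φ g)

theorem tdeg_map {R S : Type*} [CommRing R] [CommRing S] (φ : R →+* S) (hφ : Function.Injective φ) (g : MvPolynomial (Fin 3) R) :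
    (MvPolynomial.map φ g).totalDegree = g.totalDegree := by
  rw [MvPolynomial.totalDegree, MvPolynomial.totalDegree, MvPolynomial.support_map_of_injective _ hφ]

theorem gs_sdeg {K : Type*} [Field K] (g : MvPolynomial (Fin 3) K) (c m : ℕ) :
    (((gs g.totalDegree X (MvPolynomial.map C g)).coeff c).coeff m : K[X]).natDegree ≤ m := by
  rw [coeff_gs]
  by_cases hm : m ≤ g.totalDegree
  · rw [revAt_le hm, coeff_psi]
    refine natDegree_sum_le_of_forall_le _ _ fun k hk => ?_
    have hk' := supp_le hk
    have h3 : (MvPolynomial.map (C : K →+* K[X]) g).totalDegree ≤ g.totalDegree := tdeg_map_le C g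
    split_ifs with h
    · rw [MvPolynomial.coeff_map]
      refine (natDegree_C_mul_X_pow_le _ _).trans ?_
      omega
    · simp
  · have h1 : (psi (X : K[X]) (MvPolynomial.map C g)).natDegree < m := by
      have h3 : (MvPolynomial.map (C : K →+* K[X]) g).totalDegree ≤ g.totalDegree := tdeg_map_le C g
      have h4 := natDegree_psi (X : K[X]) (MvPolynomial.map C g)
      omega
    rw [revAt_eq_self_of_lt (by omega), coeff_eq_zero_of_natDegree_lt h1, coeff_zero, natDegree_zero]
    exact Nat.zero_le _

theorem theta_inj {K : Type*} [Field K] :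
    Function.Injective (eval₂RingHom (eval₂RingHom (algebraMap K (FractionRing (MvPolynomial (Fin 2) K)))
      (algebraMap (MvPolynomial (Fin 2) K) (FractionRing (MvPolynomial (Fin 2) K)) (MvPolynomial.X 0)))
      (algebraMap (MvPolynomial (Fin 2) K) (FractionRing (MvPolynomial (Fin 2) K)) (MvPolynomial.X 1))⁻¹) := by
  set A := MvPolynomial (Fin 2) K
  set L := FractionRing A
  set σ : L := algebraMap A L (MvPolynomial.X 0)
  set z : L := algebraMap A L (MvPolynomial.X 1)
  have hz : z ≠ 0 := by
    intro h
    exact MvPolynomial.X_ne_zero (R := K) (1 : Fin 2) (IsFractionRing.injective A L (h.trans (map_zero _).symm))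
  rw [injective_iff_map_eq_zero]
  intro p hp
  let _ : Invertible (z⁻¹) := ⟨z, mul_inv_cancel₀ hz, inv_mul_cancel₀ hz⟩
  have key := eval₂_reflect_mul_pow (eval₂RingHom (algebraMap K L) σ) (z⁻¹) p.natDegree p le_rfl
  rw [coe_eval₂RingHom] at hp
  rw [hp] at key
  have h1 : eval₂ (eval₂RingHom (algebraMap K L) σ) z (reflect p.natDegree p) = 0 :=
    (mul_eq_zero.1 key).resolve_right (pow_ne_zero _ (inv_ne_zero hz))
  set Q := reflect p.natDegree p with hQ
  let β : K[X][X] →+* A := eval₂RingHom (eval₂RingHom (algebraMap K A) (MvPolynomial.X 0)) (MvPolynomial.X 1)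
  have h2 : (algebraMap A L).comp β = eval₂RingHom (eval₂RingHom (algebraMap K L) σ) z := by
    ext
    · simp [β, ← IsScalarTower.algebraMap_apply K A L, ← MvPolynomial.algebraMap_eq]
    · simp [β, σ]
    · simp [β, z]
  have h3 : β Q = 0 := by
    apply IsFractionRing.injective A L
    rw [map_zero]
    exact (congrArg (fun f => f Q) h2).trans h1
  have h4 : ((MvPolynomial.eval₂Hom (C.comp C) ![C X, X] : A →+* K[X][X])).comp β = RingHom.id _ := by
    have hal : ∀ x : K, algebraMap K A x = MvPolynomial.C x := fun _ => rfl
    apply Polynomial.ringHom_ext'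
    · apply Polynomial.ringHom_ext
      · intro a; simp [β, hal]
      · simp [β]
    · simp [β]
  have h5 : Q = 0 := by
    have := congrArg (fun f => f Q) h4
    simp only [RingHom.comp_apply, h3, map_zero, RingHom.id_apply] at this
    exact this.symm
  rwa [hQ, reflect_eq_zero_iff] at h5

theorem gs_hres {K : Type*} [Field K] (g : MvPolynomial (Fin 3) K) (hg : Irreducible g) (hn : 0 < g.totalDegree)
    (h1 : ((psi 0 g).coeff g.totalDegree).coeff g.totalDegree = 1) (u : K[X][X][X]) (hu : u ≠ 0)
    (hun : u.natDegree < g.totalDegree) :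
    resultant (gs g.totalDegree X (MvPolynomial.map C g)) u g.totalDegree u.natDegree ≠ 0 := by
  set n := g.totalDegree with hnd
  set G := gs n X (MvPolynomial.map (C : K →+* K[X]) g) with hG
  have htd : (MvPolynomial.map (C : K →+* K[X]) g).totalDegree = n := tdeg_map C C_injective g
  have h1' : ((psi (X : K[X]) (MvPolynomial.map C g)).coeff n).coeff n = 1 := by
    have := coeff_psi_top (X : K[X]) (C 0) (MvPolynomial.map C g)
    rw [htd, psi_map] at this
    rw [this, coeff_map, coe_mapRingHom, coeff_map, h1, C_1]
  have hGm : G.Monic := by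
    have := gs_monic (X : K[X]) (MvPolynomial.map C g)
    rw [htd] at this
    exact this h1'
  have hGn : G.natDegree = n := by
    have := gs_natDegree (X : K[X]) (MvPolynomial.map C g)
    rw [htd] at this
    exact this h1'
  refine resultant_ne_zero_of_irred _ (theta_inj (K := K)) G u n hGn ?_ hu hun
  set A := MvPolynomial (Fin 2) K
  set L := FractionRing A
  set σ : L := algebraMap A L (MvPolynomial.X 0) with hσ
  set z : L := algebraMap A L (MvPolynomial.X 1) with hzd
  have hz : z ≠ 0 := by
    intro h
    exact MvPolynomial.X_ne_zero (R := K) (1 : Fin 2) (IsFractionRing.injective A L (h.trans (map_zero _).symm))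
  set θ := eval₂RingHom (eval₂RingHom (algebraMap K L) σ) z⁻¹ with hθ
  set φ : K[X] →+* L[X] := C.comp (eval₂RingHom (algebraMap K L) σ) with hφ
  have key := gs_eval φ (X : K[X]) (MvPolynomial.map C g) (C z⁻¹) (C z) X
    (by rw [← C_mul, inv_mul_cancel₀ hz, C_1])
  rw [htd, ← hG] at key
  set P := (MvPolynomial.finSuccEquiv K 2 g).map (algebraMap A L) with hP
  have e1 : MvPolynomial.eval₂ φ ![X, φ X, C z] (MvPolynomial.map C g) = P := by
    have : ((MvPolynomial.eval₂Hom φ ![X, φ X, C z]).comp (MvPolynomial.map (C : K →+* K[X]))) =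
        (mapRingHom (algebraMap A L)).comp ((MvPolynomial.finSuccEquiv K 2 : _ ≃ₐ[K] _) : MvPolynomial (Fin 3) K →+* _) := by
      apply MvPolynomial.ringHom_ext
      · intro r
        have h5 : (MvPolynomial.finSuccEquiv K 2) (MvPolynomial.C r) = C (algebraMap K A r) := by
          rw [← MvPolynomial.algebraMap_eq, AlgEquiv.commutes]; rfl
        have h6 : ((MvPolynomial.finSuccEquiv K 2 : _ ≃ₐ[K] _) : MvPolynomial (Fin 3) K →+* A[X]) (MvPolynomial.C r) = C (algebraMap K A r) := h5
        change _ = (mapRingHom (algebraMap A L)) (((MvPolynomial.finSuccEquiv K 2 : _ ≃ₐ[K] _) : MvPolynomial (Fin 3) K →+* A[X]) (MvPolynomial.C r))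
        rw [h6]
        simp [hφ, ← IsScalarTower.algebraMap_apply K A L]
      · intro i; fin_cases i
        · simp [MvPolynomial.finSuccEquiv_apply]
        · have h6 : ((MvPolynomial.finSuccEquiv K 2 : _ ≃ₐ[K] _) : MvPolynomial (Fin 3) K →+* A[X]) (MvPolynomial.X 1) = C (MvPolynomial.X 0) :=
            MvPolynomial.finSuccEquiv_X_succ (j := 0)
          change _ = (mapRingHom (algebraMap A L)) (((MvPolynomial.finSuccEquiv K 2 : _ ≃ₐ[K] _) : MvPolynomial (Fin 3) K →+* A[X]) (MvPolynomial.X 1))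
          rw [h6]
          simp [hφ, hσ]
        · have h6 : ((MvPolynomial.finSuccEquiv K 2 : _ ≃ₐ[K] _) : MvPolynomial (Fin 3) K →+* A[X]) (MvPolynomial.X 2) = C (MvPolynomial.X 1) :=
            MvPolynomial.finSuccEquiv_X_succ (j := 1)
          change _ = (mapRingHom (algebraMap A L)) (((MvPolynomial.finSuccEquiv K 2 : _ ≃ₐ[K] _) : MvPolynomial (Fin 3) K →+* A[X]) (MvPolynomial.X 2))
          rw [h6]
          simp [hφ, hzd]
    exact congrArg (fun f => f g) this
  have e2 : eval₂ (eval₂RingHom φ (C z⁻¹)) (C z⁻¹ * X) G = (G.map θ).comp (C z⁻¹ * X) := by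
    rw [comp, eval₂_map]
    congr 1
    ext <;> simp [hφ, hθ]
  rw [e1, e2] at key
  have hzu : IsUnit (C z⁻¹ ^ n : L[X]) := (isUnit_C.2 (isUnit_iff_ne_zero.2 (inv_ne_zero hz))).pow n
  have hPd : P.natDegree = n := by
    have := congrArg natDegree key
    rw [natDegree_comp, natDegree_C_mul_X _ (inv_ne_zero hz), hGm.natDegree_map, hGn, mul_one, ← C_pow,
      natDegree_C_mul (pow_ne_zero _ (inv_ne_zero hz))] at this
    exact this.symm
  have hPirr : Irreducible P := by
    have hgi : Irreducible (MvPolynomial.finSuccEquiv K 2 g) := (MulEquiv.irreducible_iff (MvPolynomial.finSuccEquiv K 2)).2 hg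
    have hnd0 : (MvPolynomial.finSuccEquiv K 2 g).natDegree ≠ 0 := by
      have := natDegree_map_le (f := algebraMap A L) (p := MvPolynomial.finSuccEquiv K 2 g)
      rw [← hP, hPd] at this
      omega
    have hprim := hgi.isPrimitive hnd0
    have : IsGCDMonoid A := inferInstance
    exact (hprim.irreducible_iff_irreducible_map_fraction_map (K := L)).1 hgi
  have hcomp : Irreducible ((G.map θ).comp (C z⁻¹ * X)) := by
    rw [key]
    exact (irreducible_isUnit_mul hzu).2 hPirr
  let _ : Invertible (z⁻¹) := ⟨z, mul_inv_cancel₀ hz, inv_mul_cancel₀ hz⟩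
  have := (MulEquiv.irreducible_iff (algEquivCMulXAddC (z⁻¹) 0) (x := G.map θ)).1 (by
    rw [algEquivCMulXAddC_apply, C_0, add_zero, ← comp_eq_aeval]
    exact hcomp)
  exact this

theorem natDegree_eval_W2 {R : Type*} [CommRing R] (G : R[X][X]) (n : ℕ) (hG : G ∈ W2 R n) (hGn : G.natDegree ≤ n)
    (p : R[X]) (hp : p.natDegree ≤ 1) : (G.eval p).natDegree ≤ n := by
  rw [eval_eq_sum_range]
  refine natDegree_sum_le_of_forall_le _ _ fun c hc => ?_
  rw [Finset.mem_range] at hc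
  have h1 : (G.coeff c).natDegree ≤ n - c := by
    rw [natDegree_le_iff_coeff_eq_zero]
    intro m hm
    by_contra h
    have := mem_W2.1 hG c m h
    omega
  refine natDegree_mul_le.trans ?_
  have h2 : (p ^ c).natDegree ≤ c * 1 := natDegree_pow_le.trans (Nat.mul_le_mul_left c hp)
  omega

theorem eval_eval_map {R : Type*} [CommRing R] (G : R[X][X]) (p : R[X]) (t : R) :
    (G.eval p).eval t = (G.map (evalRingHom t)).eval (p.eval t) := by
  rw [eval_map, ← coe_evalRingHom t, eval₂_hom]

theorem sep_of_res {F : Type*} [Field F] (γ : F[X]) (n : ℕ) (hn : 1 ≤ n) (hγ : γ.natDegree ≤ n)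
    (h : resultant γ γ.derivative n (n-1) ≠ 0) : γ.Separable := by
  obtain ⟨p, r, -, -, e⟩ := exists_mul_add_mul_eq_C_resultant γ γ.derivative (m := n) (n := n - 1) hγ
    ((natDegree_derivative_le _).trans (by omega)) (Or.inl (by omega))
  refine ⟨C (resultant γ γ.derivative n (n-1))⁻¹ * p, C (resultant γ γ.derivative n (n-1))⁻¹ * r, ?_⟩
  have : C (resultant γ γ.derivative n (n-1))⁻¹ * C (resultant γ γ.derivative n (n-1)) = 1 := by
    rw [← C_mul, inv_mul_cancel₀ h, C_1]
  rw [← this, ← e]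
  ring

theorem res_of_sep {F : Type*} [Field F] (γ : F[X]) (n : ℕ) (hn : 1 ≤ n) (hγ : γ.natDegree = n)
    (h : γ.Separable) : resultant γ γ.derivative n (n-1) ≠ 0 := by
  have h0 := resultant_ne_zero γ γ.derivative h
  have hd : γ.derivative.natDegree ≤ n - 1 := (natDegree_derivative_le _).trans (by omega)
  obtain ⟨k, hk⟩ := Nat.exists_eq_add_of_le hd
  rw [hk, resultant_add_right_deg _ _ _ _ _ le_rfl]
  rw [hγ] at h0
  refine mul_ne_zero (pow_ne_zero _ ?_) h0
  rw [← hγ, coeff_natDegree, leadingCoeff_ne_zero]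
  rintro rfl
  simp at hγ; omega

theorem main_core {F : Type*} [Field F] [Fintype F] [CharP F 2] (h : ℕ) (hq : Fintype.card F = 2 ^ h)
    (g : MvPolynomial (Fin 3) F) (hn : 0 < g.totalDegree) (hqn : 16 * (g.totalDegree + 2) ^ 4 < 2 ^ h)
    (hirr : Irreducible (MvPolynomial.map (algebraMap F (AlgebraicClosure F)) g)) (γ : F[X])
    (hγ : γ = (psi 0 g).coeff g.totalDegree) (hγ1 : γ.coeff g.totalDegree = 1) (hsep : γ.Separable)
    (h0 : γ.eval 0 ≠ 0) (h1 : γ.eval 1 ≠ 0)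
    (hpts : ∀ y s z : F, y ≠ s → y ≠ z → s ≠ z → MvPolynomial.eval ![y, s, z] g ≠ 0) : False := by
  classical
  set K := AlgebraicClosure F
  set φ := algebraMap F K with hφ
  set gK := MvPolynomial.map φ g with hgK
  set n := g.totalDegree with hnd
  have htK : gK.totalDegree = n := tdeg_map φ φ.injective g
  have htKC : (MvPolynomial.map (C : K →+* K[X]) gK).totalDegree = n := (tdeg_map C C_injective gK).trans htK
  have hγn : γ.natDegree = n := by
    refine natDegree_eq_of_le_of_coeff_ne_zero ?_ (by rw [hγ1]; exact one_ne_zero)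
    rw [hγ]; exact natDegree_coeff_psi 0 g n
  have hpK : (psi 0 gK).coeff n = γ.map φ := by
    have := psi_map φ 0 g
    rw [map_zero] at this
    rw [this, coeff_map, ← hγ, coe_mapRingHom]
  have hpKX : (psi (X : K[X]) (MvPolynomial.map C gK)).coeff n = (γ.map φ).map C := by
    have := coeff_psi_top (X : K[X]) (C 0) (MvPolynomial.map C gK)
    rw [htKC, psi_map] at this
    rw [this, coeff_map, coe_mapRingHom, hpK]
  have hpKX1 : ((psi (X : K[X]) (MvPolynomial.map C gK)).coeff n).coeff n = 1 := by
    rw [hpKX, coeff_map, coeff_map, hγ1, map_one, map_one]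
  obtain ⟨ζ, hζ⟩ := IsAlgClosed.exists_root (γ.map φ) (by
    rw [degree_map]; intro h
    have := natDegree_eq_zero_iff_degree_le_zero.2 h.le
    omega)
  have hζ' : (γ.map φ).derivative.eval ζ ≠ 0 := by
    have hs : (γ.map φ).Separable := hsep.map
    obtain ⟨a, b, hab⟩ := hs
    intro h
    have := congrArg (eval ζ) hab
    rw [eval_add, eval_mul, eval_mul, h, hζ] at this
    simp at this
  have hcard : 2 * n ^ 4 + 2 * n ^ 3 < Fintype.card F := by
    rw [hq]; refine lt_of_le_of_lt ?_ hqn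
    have : n ^ 3 ≤ (n+2)^4 := (Nat.pow_le_pow_left (by omega) 3).trans (Nat.pow_le_pow_right (by omega) (by omega))
    have : n ^ 4 ≤ (n+2)^4 := Nat.pow_le_pow_left (by omega) 4
    omega
  have hb := bertini φ n hn hcard (gs n X (MvPolynomial.map C gK))
    (by have := gs_monic (X : K[X]) (MvPolynomial.map C gK); rw [htKC] at this; exact this hpKX1)
    (by have := gs_natDegree (X : K[X]) (MvPolynomial.map C gK); rw [htKC] at this; exact this hpKX1)
    (by have := gs_coeff_natDegree (X : K[X]) (MvPolynomial.map C gK); rw [htKC] at this; exact this)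
    (by have := gs_sdeg gK; rw [htK] at this; exact this) (γ.map φ)
    (by have := gs_constantCoeff (X : K[X]) (MvPolynomial.map C gK); rw [htKC, hpKX] at this; exact this)
    ζ hζ hζ'
    (by
      have := gs_hres gK hirr (by omega) (by rw [htK, hpK, coeff_map, hγ1, map_one])
      rw [htK] at this; exact this)
  obtain ⟨s0, ξ0, hξ0, hres⟩ := hb
  have hGe : (gs n X (MvPolynomial.map (C : K →+* K[X]) gK)).map (mapRingHom (evalRingHom (φ s0))) =
      (gs n s0 g).map (mapRingHom φ) := by
    rw [← gs_map, ← gs_map, MvPolynomial.map_map]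
    have e1 : (evalRingHom (φ s0)).comp C = RingHom.id K := by ext; simp
    rw [e1, MvPolynomial.map_id]
    simp [hgK]
  rw [hGe] at hξ0 hres
  have hps : (psi s0 g).coeff n = γ := by rw [hγ]; exact coeff_psi_top s0 0 g
  have hps1 : ((psi s0 g).coeff n).coeff n = 1 := by rw [hps, hγ1]
  set G := gs n s0 g with hG
  have hGm : G.Monic := gs_monic s0 g hps1
  have hGn : G.natDegree = n := gs_natDegree s0 g hps1
  have hGw : G ∈ W2 F n := gs_W2 s0 g
  have hGd : ∀ c, (G.coeff c).natDegree ≤ n := gs_coeff_natDegree s0 g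
  have hG0 : G.map (evalRingHom 0) = γ := by
    have := gs_constantCoeff s0 g
    rw [← hps, ← this]
    congr 1
    ext <;> simp
  set Rs := resultant G G.derivative n (n-1) with hRs
  have hRe : ∀ t, Rs.eval t = resultant (G.map (evalRingHom t)) (G.map (evalRingHom t)).derivative n (n-1) := by
    intro t
    rw [derivative_map, resultant_map_map]; rfl
  set B1 : F[X] := (C s0 * X - 1) * G.eval 1 * G.eval (C s0 * X) * Rs with hB1
  have hB10 : B1.eval 0 ≠ 0 := by
    rw [hB1, eval_mul, eval_mul, eval_mul, eval_eval_map, eval_eval_map, hRe, hG0]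
    refine mul_ne_zero (mul_ne_zero (mul_ne_zero (by simp) (by simpa using h1)) (by simpa using h0)) ?_
    exact res_of_sep γ n hn hγn hsep
  have hB0 : X * B1 ≠ 0 := by
    refine mul_ne_zero X_ne_zero ?_
    rintro h; rw [h] at hB10; simp at hB10
  have hBd : (X * B1).natDegree ≤ 2 * n ^ 2 + 2 * n + 2 := by
    have d1 : (C s0 * X : F[X]).natDegree ≤ 1 := (natDegree_C_mul_le _ _).trans natDegree_X_le
    have d2 : (C s0 * X - 1 : F[X]).natDegree ≤ 1 := (natDegree_sub_le _ _).trans (max_le d1 (by simp))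
    have d3 := natDegree_eval_W2 G n hGw hGn.le 1 (by simp)
    have d4 := natDegree_eval_W2 G n hGw hGn.le _ d1
    have d5 : Rs.natDegree ≤ n * n + (n-1) * n := natDegree_resultant_le G _ n (n-1) n n hGd (by
      intro c
      rw [coeff_derivative]
      refine natDegree_mul_le.trans ?_
      have : ((c : F[X]) + 1).natDegree = 0 := by
        have : ((c : F[X]) + 1) = ((c + 1 : ℕ) : F[X]) := by push_cast; rfl
        rw [this, natDegree_natCast]
      rw [this, add_zero]; exact hGd _)
    have d6 : (n-1) * n ≤ n * n := Nat.mul_le_mul_right _ (by omega)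
    have d7 : (X : F[X]).natDegree ≤ 1 := natDegree_X_le
    have m1 := natDegree_mul_le (p := X) (q := B1)
    have m2 := natDegree_mul_le (p := (C s0 * X - 1) * G.eval 1 * G.eval (C s0 * X)) (q := Rs)
    have m3 := natDegree_mul_le (p := (C s0 * X - 1) * G.eval 1) (q := G.eval (C s0 * X))
    have m4 := natDegree_mul_le (p := (C s0 * X - 1)) (q := G.eval 1)
    rw [← hB1] at m2
    have : n ^ 2 = n * n := sq n
    omega
  refine curve_thm h n hq hn hqn G hGm hGn hGw ξ0 hξ0 hres (Finset.univ.filter fun t => (X * B1).eval t ≠ 0) ?_ ?_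
  · have hc := Finset.card_filter_add_card_filter_not (s := (Finset.univ : Finset F)) (fun t => (X * B1).eval t ≠ 0)
    rw [Finset.card_univ, hq] at hc
    have : (Finset.univ.filter fun t => ¬ (X * B1).eval t ≠ 0).card ≤ (X * B1).natDegree := by
      refine le_trans (Finset.card_le_card (t := (X * B1).roots.toFinset) ?_)
        ((Multiset.toFinset_card_le _).trans (card_roots' _))
      intro t ht
      rw [Finset.mem_filter, not_not] at ht
      rw [Multiset.mem_toFinset, mem_roots hB0]
      exact ht.2
    omega
  · intro t ht
    rw [Finset.mem_filter] at ht
    have ht := ht.2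
    rw [hB1, eval_mul, eval_mul, eval_mul, eval_mul, eval_eval_map, eval_eval_map, hRe] at ht
    simp only [mul_ne_zero_iff, eval_X, eval_sub, eval_mul, eval_C, eval_one] at ht
    obtain ⟨ht0, ⟨⟨ht1, ht2⟩, ht3⟩, ht4⟩ := ht
    refine ⟨sep_of_res _ n hn (natDegree_map_le.trans hGn.le) ht4, fun x hx => ?_⟩
    have key := gs_eval (RingHom.id F) s0 g t t⁻¹ (t⁻¹ * x) (mul_inv_cancel₀ ht0)
    rw [← mul_assoc, mul_inv_cancel₀ ht0, one_mul, ← hnd, ← hG] at key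
    rw [eval_map] at hx
    have e : eval₂ (eval₂RingHom (RingHom.id F) t) x G = 0 := hx
    rw [e] at key
    have k2 := (mul_eq_zero.1 key.symm).resolve_left (pow_ne_zero _ ht0)
    refine hpts (t⁻¹ * x) s0 t⁻¹ ?_ ?_ ?_ k2
    · rintro h
      apply ht3
      rw [eval_map, ← h, mul_comm, ← mul_assoc, mul_inv_cancel₀ ht0, one_mul]; exact hx
    · intro h
      apply ht2
      have : x = 1 := by
        have := congrArg (t * ·) h
        simpa [mul_inv_cancel₀ ht0, ← mul_assoc] using this
      rw [eval_map, ← this]; exact hx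
    · intro h
      apply ht1
      rw [h, inv_mul_cancel₀ ht0, sub_self]

theorem sum_eval_eq_zero {F : Type*} [Field F] [Fintype F] (p : F[X]) (hp : p.natDegree < Fintype.card F - 1) :
    ∑ x : F, p.eval x = 0 := by
  simp only [eval_eq_sum_range]
  rw [Finset.sum_comm]
  refine Finset.sum_eq_zero fun i hi => ?_
  rw [← Finset.mul_sum, FiniteField.sum_pow_lt_card_sub_one, mul_zero]
  rw [Finset.mem_range] at hi
  omega

theorem even_deg {F : Type*} [Field F] [Fintype F] [CharP F 2] (f : F[X]) (hd1 : 1 ≤ f.natDegree)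
    (hd : f.natDegree + 2 < Fintype.card F) (hinj : Function.Injective fun x => f.eval x)
    (hdet : ∀ a b c : F, a ≠ b → a ≠ c → b ≠ c →
      Matrix.det !![1, 1, 1; a, b, c; f.eval a, f.eval b, f.eval c] ≠ 0) : Even f.natDegree := by
  classical
  have hder : ∀ s : F, f.derivative.eval s = 0 := by
    intro s
    set p := divX (taylor s f) with hp
    have hpd : p.natDegree < Fintype.card F - 1 := by
      rw [hp, natDegree_divX_eq_natDegree_tsub_one, natDegree_taylor]; omega
    have hpe : ∀ x, p.eval x * x = f.eval (x + s) - f.eval s := by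
      intro x
      have h1 := congrArg (eval x) (divX_mul_X_add (taylor s f))
      rw [eval_add, eval_mul, eval_X, eval_C, taylor_eval, taylor_coeff_zero] at h1
      rw [← h1, hp]; ring
    have hpn : ∀ x, x ≠ 0 → p.eval x ≠ 0 := by
      intro x hx h0
      have := hpe x
      rw [h0, zero_mul, eq_comm, sub_eq_zero] at this
      have := hinj this
      exact hx (by simpa using this)
    have hpi : ∀ x y, x ≠ 0 → y ≠ 0 → p.eval x = p.eval y → x = y := by
      intro x y hx hy hxy
      by_contra hne
      refine hdet s (x + s) (y + s) (by simpa using hx) (by simpa using hy) (by simpa using hne) ?_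
      rw [Matrix.det_fin_three]
      simp
      linear_combination y * hpe x - x * hpe y - x * y * hxy
    let σ : F → F := fun x => if x = 0 then 0 else p.eval x
    have hσ : Function.Injective σ := by
      intro x y hxy
      simp only [σ] at hxy
      split_ifs at hxy with h1 h2 h2
      · rw [h1, h2]
      · exact absurd hxy.symm (hpn y h2)
      · exact absurd hxy (hpn x h1)
      · exact hpi x y h1 h2 hxy
    have hs1 : ∑ x, σ x = 0 := by
      have hb := Finite.injective_iff_bijective.1 hσ
      rw [Function.Bijective.sum_comp hb (fun x => x)]
      have := sum_eval_eq_zero (X : F[X]) (natDegree_X_le.trans_lt (by omega))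
      simpa using this
    have hs2 := sum_eval_eq_zero p hpd
    have hs3 : p.eval 0 = 0 := by
      rw [← Finset.add_sum_erase _ _ (Finset.mem_univ (0:F))] at hs1 hs2
      have : ∑ x ∈ Finset.univ.erase 0, σ x = ∑ x ∈ Finset.univ.erase 0, p.eval x :=
        Finset.sum_congr rfl fun x hx => if_neg (Finset.ne_of_mem_erase hx)
      rw [this] at hs1
      simp only [σ, if_pos] at hs1
      rw [zero_add] at hs1
      rw [hs1, add_zero] at hs2
      exact hs2
    rw [← coeff_zero_eq_eval_zero, hp, coeff_divX, zero_add, taylor_coeff_one] at hs3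
    exact hs3
  have hf' : f.derivative = 0 := by
    refine eq_zero_of_natDegree_lt_card_of_eval_eq_zero _ Function.injective_id hder ?_
    have := natDegree_derivative_le f
    omega
  have h1 := congrArg (fun p => p.coeff (f.natDegree - 1)) hf'
  simp only [coeff_derivative, coeff_zero] at h1
  rw [Nat.sub_add_cancel hd1, coeff_natDegree] at h1
  have hf0 : f ≠ 0 := by rintro rfl; simp at hd1
  have h2 := (mul_eq_zero.1 h1).resolve_left (leadingCoeff_ne_zero.2 hf0)
  have h3 : ((f.natDegree : ℕ) : F) = 0 := by
    rw [← h2]; rw [← Nat.cast_add_one, Nat.sub_add_cancel hd1]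
  rw [CharP.cast_eq_zero_iff F 2] at h3
  exact even_iff_two_dvd.2 h3

theorem tdeg_aeval_le {F : Type*} [Field F] (f : F[X]) (i : Fin 3) :
    (aeval (MvPolynomial.X i : MvPolynomial (Fin 3) F) f).totalDegree ≤ f.natDegree := by
  rw [aeval_eq_sum_range]
  refine MvPolynomial.totalDegree_finsetSum_le fun k hk => ?_
  rw [Finset.mem_range] at hk
  refine (MvPolynomial.totalDegree_smul_le _ _).trans ?_
  refine (MvPolynomial.totalDegree_pow _ _).trans ?_
  rw [MvPolynomial.totalDegree_X]; omega

theorem tdeg_numer_le {F : Type*} [Field F] (f : F[X]) : (numer F f).totalDegree ≤ f.natDegree + 1 := by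
  have key : ∀ i j k : Fin 3, (MvPolynomial.X i * (aeval (MvPolynomial.X j : MvPolynomial (Fin 3) F) f +
      aeval (MvPolynomial.X k : MvPolynomial (Fin 3) F) f)).totalDegree ≤ f.natDegree + 1 := by
    intro i j k
    refine (MvPolynomial.totalDegree_mul _ _).trans ?_
    rw [MvPolynomial.totalDegree_X, add_comm]
    gcongr
    exact (MvPolynomial.totalDegree_add _ _).trans (max_le (tdeg_aeval_le f j) (tdeg_aeval_le f k))
  rw [numer]
  refine (MvPolynomial.totalDegree_add _ _).trans (max_le ((MvPolynomial.totalDegree_add _ _).trans (max_le ?_ ?_)) ?_) <;>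
  exact key _ _ _

theorem psi_denom {F : Type*} [Field F] : psi 0 (denom F) = C (X * (X + 1)) * X ^ 3 := by
  simp [psi, denom]
  ring

theorem psi_numer {F : Type*} [Field F] (f : F[X]) (hd : 2 ≤ f.natDegree) :
    (psi 0 (numer F f)).coeff (f.natDegree + 1) = C f.leadingCoeff * (X + X ^ f.natDegree) := by
  have h : ∀ i, psi 0 (aeval (MvPolynomial.X i : MvPolynomial (Fin 3) F) f) =
      eval₂ (C.comp C) (![C X * X, C (C 0), X] i : F[X][X]) f := by
    intro i
    rw [aeval_def, hom_eval₂]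
    congr 1
    · ext a; simp [psi, MvPolynomial.algebraMap_eq]
    · simp [psi]
  have hX : ∀ i, psi 0 (MvPolynomial.X i : MvPolynomial (Fin 3) F) = ![C X * X, C (C 0), X] i := by
    intro i; simp [psi]
  have c2 : (eval₂ (C.comp C) (X : F[X][X]) f).coeff f.natDegree = C f.leadingCoeff := by
    rw [eval₂_eq_sum_range, finsetSum_coeff, Finset.sum_eq_single f.natDegree]
    · simp
    · intro b _ hb; simp [coeff_X_pow, hb.symm]
    · simp
  have c0 : (eval₂ (C.comp C) (C X * X : F[X][X]) f).coeff f.natDegree = C f.leadingCoeff * X ^ f.natDegree := by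
    have hb : ∀ b, ((C.comp C : F →+* F[X][X]) (f.coeff b) * (C X * X : F[X][X]) ^ b).coeff f.natDegree =
        (C (f.coeff b) * X ^ b) * (if f.natDegree = b then 1 else 0) := by
      intro b
      have : (C.comp C : F →+* F[X][X]) (f.coeff b) * (C X * X : F[X][X]) ^ b =
          C (C (f.coeff b) * X ^ b) * X ^ b := by
        rw [mul_pow, C_mul, C_pow, RingHom.comp_apply, mul_assoc]
      rw [this, coeff_C_mul, coeff_X_pow]
    rw [eval₂_eq_sum_range, finsetSum_coeff, Finset.sum_eq_single f.natDegree]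
    · rw [hb, if_pos rfl, mul_one, coeff_natDegree]
    · intro b _ hne
      rw [hb, if_neg hne.symm, mul_zero]
    · simp
  have c1 : (eval₂ (C.comp C) (C (C 0) : F[X][X]) f).coeff f.natDegree = 0 := by
    have : eval₂ (C.comp C) (C (C 0) : F[X][X]) f = C (C (f.eval 0)) := by
      have := eval₂_hom (p := f) (C.comp C : F →+* F[X][X]) 0
      simpa using this
    rw [this, coeff_C_of_ne_zero (by omega)]
  simp only [numer, map_add, map_mul, h, hX]
  have e0 : (![C X * X, C (C 0), X] : Fin 3 → F[X][X]) 0 = C X * X := rfl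
  have e1 : (![C X * X, C (C 0), X] : Fin 3 → F[X][X]) 1 = C (C 0) := rfl
  have e2 : (![C X * X, C (C 0), X] : Fin 3 → F[X][X]) 2 = X := rfl
  rw [e0, e1, e2]
  rw [coeff_add, coeff_add, mul_assoc, coeff_C_mul, coeff_X_mul, coeff_X_mul, coeff_add, coeff_add, c0, c1, c2]
  simp
  ring

theorem gamma_factor {F : Type*} [Field F] [CharP F 2] (f : F[X]) (hd : 2 ≤ f.natDegree)
    (hev : Even f.natDegree) (g k : MvPolynomial (Fin 3) F) (hgk : denom F * (g * k) = numer F f) :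
    g.totalDegree + 2 ≤ f.natDegree ∧
    ((psi 0 g).coeff g.totalDegree).natDegree = g.totalDegree ∧
    (psi 0 g).coeff g.totalDegree ≠ 0 ∧
    ((psi 0 g).coeff g.totalDegree).Separable ∧
    ((psi 0 g).coeff g.totalDegree).eval 0 ≠ 0 ∧ ((psi 0 g).coeff g.totalDegree).eval 1 ≠ 0 := by
  obtain ⟨d, hdd⟩ : ∃ d, f.natDegree = d + 2 := ⟨f.natDegree - 2, by omega⟩
  have hf0 : f ≠ 0 := by rintro rfl; simp at hd
  have hlc : f.leadingCoeff ≠ 0 := leadingCoeff_ne_zero.2 hf0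
  have hnum := psi_numer f hd
  have hXX : (X + X ^ f.natDegree : F[X]) ≠ 0 := by
    intro h
    have := congrArg (fun p => p.coeff 1) h
    simp [coeff_X_pow, show 1 ≠ f.natDegree by omega] at this
  have htop : C f.leadingCoeff * (X + X ^ f.natDegree : F[X]) ≠ 0 := mul_ne_zero (by simpa using hlc) hXX
  have hn0 : numer F f ≠ 0 := by
    intro h
    rw [h, map_zero, coeff_zero] at hnum
    exact htop hnum.symm
  have hD0 : denom F ≠ 0 := by rintro h; rw [h, zero_mul] at hgk; exact hn0 hgk.symm
  have hG0 : g * k ≠ 0 := by intro h; rw [h, mul_zero] at hgk; exact hn0 hgk.symm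
  have hg0 : g ≠ 0 := left_ne_zero_of_mul hG0
  have hk0 : k ≠ 0 := right_ne_zero_of_mul hG0
  have hXX1 : (X * (X + 1) : F[X]) ≠ 0 := mul_ne_zero X_ne_zero (by
    have := X_add_C_ne_zero (1 : F); simpa using this)
  have hD3 : 3 ≤ (denom F).totalDegree := by
    have h1 := natDegree_psi 0 (denom F)
    rw [psi_denom, natDegree_C_mul_X_pow _ _ hXX1] at h1
    exact h1
  have htd : (denom F).totalDegree + (g.totalDegree + k.totalDegree) ≤ f.natDegree + 1 := by
    have h1 := tdeg_numer_le f
    rw [← hgk, MvPolynomial.totalDegree_mul_of_isDomain hD0 hG0,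
      MvPolynomial.totalDegree_mul_of_isDomain hg0 hk0] at h1
    exact h1
  have hc : X * (X + 1) * (psi 0 g * psi 0 k).coeff d = C f.leadingCoeff * (X + X ^ f.natDegree) := by
    rw [← hnum, ← hgk, map_mul, psi_denom, map_mul (psi 0) g k, mul_assoc (C _) (X ^ 3), coeff_C_mul, hdd,
      show d + 2 + 1 = d + 3 from rfl, coeff_X_pow_mul]
  have hsum : g.totalDegree + k.totalDegree = d := by
    by_contra hne
    have : (psi 0 g * psi 0 k).natDegree < d := by
      refine natDegree_mul_le.trans_lt ?_
      have := natDegree_psi 0 g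
      have := natDegree_psi 0 k
      omega
    rw [coeff_eq_zero_of_natDegree_lt this, mul_zero] at hc
    exact htop hc.symm
  rw [← hsum, coeff_mul_add_eq_of_natDegree_le (natDegree_psi 0 g) (natDegree_psi 0 k)] at hc
  have hdg := natDegree_coeff_psi 0 g g.totalDegree
  have hdk := natDegree_coeff_psi 0 k k.totalDegree
  set a := (psi 0 g).coeff g.totalDegree
  set b := (psi 0 k).coeff k.totalDegree
  have hcan : (X + 1) * (a * b) = C f.leadingCoeff * (X ^ (d + 1) - 1) := by
    refine mul_left_cancel₀ X_ne_zero ?_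
    rw [CharTwo.sub_eq_add, ← mul_assoc, hc, hdd]
    ring
  have hsep : ((X + 1) * (a * b)).Separable := by
    rw [hcan]
    have h1 : (X ^ (d + 1) - 1 : F[X]).Separable := by
      rw [X_pow_sub_one_separable_iff]
      intro h
      rw [CharP.cast_eq_zero_iff F 2] at h
      rw [hdd] at hev
      have := even_iff_two_dvd.1 hev
      omega
    exact h1.unit_mul (isUnit_C.2 hlc.isUnit)
  have hab0 : a * b ≠ 0 := by
    intro h; rw [h, mul_zero] at hc; exact htop hc.symm
  have ha0 := left_ne_zero_of_mul hab0
  have hb0 := right_ne_zero_of_mul hab0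
  have hdeg : a.natDegree + b.natDegree = d := by
    have h1 := congrArg natDegree hcan
    have h2 : (X ^ (d + 1) - 1 : F[X]).natDegree = d + 1 := by
      simpa using natDegree_X_pow_sub_C (n := d + 1) (r := (1 : F))
    rw [natDegree_C_mul hlc, h2,
      natDegree_mul (right_ne_zero_of_mul hXX1) hab0, natDegree_mul ha0 hb0] at h1
    have : (X + 1 : F[X]).natDegree = 1 := by simpa using natDegree_X_add_C (1 : F)
    omega
  refine ⟨by omega, by omega, ha0, hsep.of_dvd ⟨(X + 1) * b, by ring⟩, ?_, ?_⟩
  · intro h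
    have h1 := congrArg (eval 0) hcan
    simp [h] at h1
    exact hf0 h1
  · intro h
    have h1 := (hsep.isCoprime)
    obtain ⟨u, v, huv⟩ := h1
    have h2 := congrArg (eval 1) huv
    have h3 : (1 + 1 : F) = 0 := CharTwo.add_self_eq_zero 1
    simp [h, h3] at h2

theorem final_core {F : Type*} [Field F] [Fintype F] [CharP F 2] (h : ℕ) (hq : Fintype.card F = 2 ^ h)
    (f : F[X]) (hd : 2 ≤ f.natDegree) (hev : Even f.natDegree) (hqd : 16 * f.natDegree ^ 4 < 2 ^ h)
    (hdet : ∀ a b c : F, a ≠ b → a ≠ c → b ≠ c →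
      Matrix.det !![1, 1, 1; a, b, c; f.eval a, f.eval b, f.eval c] ≠ 0)
    (g k : MvPolynomial (Fin 3) F) (hgk : denom F * (g * k) = numer F f) (hn : 0 < g.totalDegree)
    (hirr : Irreducible (MvPolynomial.map (algebraMap F (AlgebraicClosure F)) g))
    (h1 : ((psi 0 g).coeff g.totalDegree).coeff g.totalDegree = 1) : False := by
  obtain ⟨e1, e2, e3, e4, e5, e6⟩ := gamma_factor f hd hev g k hgk
  refine main_core h hq g hn ?_ hirr _ rfl h1 e4 e5 e6 ?_
  · refine lt_of_le_of_lt ?_ hqd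
    gcongr
  · intro y s z hys hyz hsz h0
    refine hdet y s z hys hyz hsz ?_
    have h2 := congrArg (MvPolynomial.eval ![y, s, z]) hgk
    rw [map_mul, map_mul, h0, zero_mul, mul_zero] at h2
    have hev' : ∀ i, MvPolynomial.eval ![y, s, z] (aeval (MvPolynomial.X i : MvPolynomial (Fin 3) F) f) =
        f.eval (![y, s, z] i) := by
      intro i
      have hid : (MvPolynomial.eval ![y, s, z]).comp (algebraMap F (MvPolynomial (Fin 3) F)) = RingHom.id F := by
        refine RingHom.ext fun a => ?_
        rw [RingHom.comp_apply, MvPolynomial.algebraMap_eq, MvPolynomial.eval_C, RingHom.id_apply]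
      rw [aeval_def, hom_eval₂, MvPolynomial.eval_X, hid, eval₂_id]
    simp only [numer, map_add, map_mul, hev', MvPolynomial.eval_X] at h2
    simp at h2
    rw [Matrix.det_fin_three]
    simp
    simp only [CharTwo.sub_eq_add]
    rw [h2]
    ring

/-- If `deg f < (1/2) q^(1/4)` and `Φ_f` has an absolutely irreducible factor over
`F_q`, then `f` is not an o-polynomial of `F_q`. -/
theorem not_opoly_of_absIrredFactor (F : Type*) [Field F] [Finite F] (h : ℕ)
    (hh : 0 < h) (hq : Nat.card F = 2 ^ h) (f : F[X])
    (hdeg : (f.natDegree : ℝ) < (1 / 2) * (Nat.card F : ℝ) ^ ((1 : ℝ) / 4))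
    (Φ : MvPolynomial (Fin 3) F) (hΦ : denom F * Φ = numer F f)
    (hirr : HasAbsIrredFactor F Φ) :
    ¬ IsOPoly F f := by
  rintro ⟨_, hbij, hf0, hf1, hdet⟩
  have := Fintype.ofFinite F
  have hq' : Fintype.card F = 2 ^ h := by rw [← hq, Nat.card_eq_fintype_card]
  have hchar : CharP F 2 := by
    obtain ⟨p, hp⟩ := CharP.exists F
    have hpp : p.Prime := (CharP.char_is_prime_or_zero F p).resolve_right (by
      rintro rfl
      exact CharP.char_ne_zero_of_finite F 0 rfl)
    have h1 : p ∣ 2 ^ h := by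
      rw [← hq', ← CharP.cast_eq_zero_iff F p]
      exact Nat.cast_card_eq_zero F
    have h2 := (Nat.prime_dvd_prime_iff_eq hpp Nat.prime_two).1 (hpp.dvd_of_dvd_pow h1)
    exact h2 ▸ hp
  have hqd : 16 * f.natDegree ^ 4 < 2 ^ h := by
    have h1 : (2 * (f.natDegree : ℝ)) < (Nat.card F : ℝ) ^ ((1 : ℝ) / 4) := by linarith
    have h2 : (2 * (f.natDegree : ℝ)) ^ 4 < ((Nat.card F : ℝ) ^ ((1 : ℝ) / 4)) ^ 4 :=
      pow_lt_pow_left₀ h1 (by positivity) (by norm_num)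
    rw [← Real.rpow_natCast, ← Real.rpow_natCast, ← Real.rpow_mul (by positivity)] at h2
    norm_num at h2
    rw [hq'] at h2
    have h3 : ((16 * f.natDegree ^ 4 : ℕ) : ℝ) < ((2 ^ h : ℕ) : ℝ) := by
      push_cast at h2 ⊢
      nlinarith [h2]
    exact_mod_cast h3
  have hd1 : 1 ≤ f.natDegree := by
    by_contra hlt
    have h0 : f.natDegree = 0 := by omega
    rw [eq_C_of_natDegree_eq_zero h0, eval_C] at hf0 hf1
    rw [hf0] at hf1
    exact zero_ne_one hf1
  have hdq : f.natDegree + 2 < Fintype.card F := by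
    rw [hq']
    refine lt_of_le_of_lt ?_ hqd
    have := Nat.le_self_pow (n := 4) (by norm_num) f.natDegree
    omega
  have hev := even_deg f hd1 hdq hbij.1 hdet
  have hd2 : 2 ≤ f.natDegree := by
    obtain ⟨r, hr⟩ := hev
    omega
  obtain ⟨g, ⟨k, rfl⟩, hn, hi⟩ := hirr
  obtain ⟨-, e2, e3, -, -, -⟩ := gamma_factor f hd2 hev g k hΦ
  set c := ((psi 0 g).coeff g.totalDegree).coeff g.totalDegree with hc
  have hc0 : c ≠ 0 := by
    rw [hc]
    nth_rewrite 2 [← e2]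
    rw [coeff_natDegree]
    exact leadingCoeff_ne_zero.2 e3
  have hg0 : g ≠ 0 := by rintro rfl; simp at hn
  have hcc : (MvPolynomial.C c⁻¹ * MvPolynomial.C c : MvPolynomial (Fin 3) F) = 1 := by
    rw [← MvPolynomial.C_mul, inv_mul_cancel₀ hc0, MvPolynomial.C_1]
  have hCi : (MvPolynomial.C c⁻¹ : MvPolynomial (Fin 3) F) ≠ 0 := left_ne_zero_of_mul (hcc ▸ one_ne_zero)
  have htd : (MvPolynomial.C c⁻¹ * g).totalDegree = g.totalDegree := by
    rw [MvPolynomial.totalDegree_mul_of_isDomain hCi hg0, MvPolynomial.totalDegree_C, zero_add]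
  refine final_core h hq' f hd2 hev hqd hdet (MvPolynomial.C c⁻¹ * g) (MvPolynomial.C c * k) ?_ ?_ ?_ ?_
  · rw [← hΦ]
    linear_combination (denom F * g * k) * hcc
  · rw [htd]; exact hn
  · rw [map_mul]
    refine (irreducible_isUnit_mul ?_).2 hi
    exact (IsUnit.of_mul_eq_one _ hcc).map _
  · rw [htd, map_mul]
    have : psi 0 (MvPolynomial.C c⁻¹ : MvPolynomial (Fin 3) F) = C (C c⁻¹) := by simp [psi]
    rw [this, coeff_C_mul, coeff_C_mul, ← hc, inv_mul_cancel₀ hc0]
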